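/- arXiv:1305.2520 — 3 statements merged into one kernel-verified Lean document; each statement's English description precedes it below -/
import Mathlib

section
/- For ξ ≥ 0 and T ≥ 2, let D(ξ;T) = ∑_{0<γ≤T} e^{2πiγξ}·(1 − e^{2πξ(β−1/2)}), where the sum runs over the nontrivial zeros ρ = β + iγ of the Riemann zeta function with 0 < γ ≤ T, counted with multiplicity. Suppose A > 0 and B > 0 are constants such that the zero-density estimate N(σ,T) ≪ T^{1−A(σ−1/2)}(log T)^B holds uniformly for σ ≥ 1/2 and T ≥ 2, where N(σ,T) is the number of nontrivial zeros ρ = β + iγ with β ≥ σ and 0 < γ ≤ T, counted with multiplicity. Then uniformly for T ≥ 3 and 1 ≤ U ≤ (A/(8π))·log T, one has ∫_0^U |D(ξ;T)|² dξ ≪ (U⁴·T/log T)·(log log T)⁴ + T^{1−A/U}·(log T)^{B+2}. -/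
open Complex
open scoped Classical

/-- The multiplicity (order of vanishing) of `f` at `ρ`. -/
noncomputable def zeroMult (f : ℂ → ℂ) (ρ : ℂ) : ℕ :=
  sSup {n : ℕ | ∃ g : ℂ → ℂ, AnalyticAt ℂ g ρ ∧ ∀ᶠ z in nhds ρ, f z = (z - ρ) ^ n * g z}

/-- `ρ` lies in the box of nontrivial zeros with `0 < Im ρ ≤ T`. -/
def inZeroBox (ρ : ℂ) (T : ℝ) : Prop :=
  0 < ρ.re ∧ ρ.re < 1 ∧ 0 < ρ.im ∧ ρ.im ≤ T

/-- `D(ξ;T) = ∑_{0<γ≤T} e^{2πiγξ}(1 - e^{2πξ(β-1/2)})`, over nontrivial zeros `ρ = β + iγ`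
of `ζ` counted with multiplicity. -/
noncomputable def Dzeta (ξ T : ℝ) : ℂ :=
  ∑' ρ : ℂ,
    if inZeroBox ρ T then
      (zeroMult riemannZeta ρ : ℂ) * Complex.exp (2 * Real.pi * Complex.I * ρ.im * ξ) *
        (1 - (Real.exp (2 * Real.pi * ξ * (ρ.re - 1 / 2)) : ℂ))
    else 0

/-- `N(σ,T)`: the number of nontrivial zeros `ρ = β + iγ` of `ζ` with `β ≥ σ` and `0 < γ ≤ T`,
counted with multiplicity. -/
noncomputable def Nzeta (σ T : ℝ) : ℝ :=
  ∑' ρ : ℂ,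
    if σ ≤ ρ.re ∧ 0 < ρ.re ∧ ρ.re < 1 ∧ 0 < ρ.im ∧ ρ.im ≤ T then
      (zeroMult riemannZeta ρ : ℝ)
    else 0

/-- The summands of the series `1 + ∑ zetaTerm n s` representing `(s - 1) ζ(s)` for `0 < re s`. -/
noncomputable def zetaTerm (n : ℕ) (s : ℂ) : ℂ :=
  (s - 1) * ((n + 1 : ℝ) : ℂ) ^ (-s) +
    (((n + 1 + 1 : ℝ) : ℂ) ^ (1 - s) - ((n + 1 : ℝ) : ℂ) ^ (1 - s))

lemma hasDerivAt_ofReal_cpow_of_pos {x : ℝ} (hx : 0 < x) (r : ℂ) :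
    HasDerivAt (fun y : ℝ ↦ (y : ℂ) ^ r) (r * (x : ℂ) ^ (r - 1)) x := by
  have h1 : HasDerivAt (fun z : ℂ ↦ z ^ r) (r * (x : ℂ) ^ (r - 1)) (x : ℂ) := by
    have := (hasDerivAt_id (x : ℂ)).cpow_const (c := r) (Or.inl (by simpa using hx))
    simpa using this
  exact h1.comp_ofReal

lemma norm_cpow_neg_sub_cpow_neg_le {a x : ℝ} (ha : 0 < a) (hax : a ≤ x) {s : ℂ} (hs : 0 < s.re) :
    ‖(x : ℂ) ^ (-s) - (a : ℂ) ^ (-s)‖ ≤ ‖s‖ * a ^ (-s.re - 1) * (x - a) := by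
  have key := (convex_Icc a x).norm_image_sub_le_of_norm_hasDerivWithin_le
    (f := fun y : ℝ ↦ (y : ℂ) ^ (-s)) (f' := fun y : ℝ ↦ -s * (y : ℂ) ^ (-s - 1))
    (C := ‖s‖ * a ^ (-s.re - 1)) (x := a) (y := x)
    (fun y hy ↦ (hasDerivAt_ofReal_cpow_of_pos (ha.trans_le hy.1) _).hasDerivWithinAt)
    (fun y hy ↦ ?_) ⟨le_rfl, hax⟩ ⟨hax, le_rfl⟩
  · rwa [Real.norm_of_nonneg (sub_nonneg.2 hax)] at key
  · rw [norm_mul, norm_neg, norm_cpow_eq_rpow_re_of_pos (ha.trans_le hy.1)]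
    gcongr
    simpa using Real.rpow_le_rpow_of_nonpos ha hy.1 (by linarith : -s.re - 1 ≤ 0)

lemma norm_zetaTerm_le (n : ℕ) {s : ℂ} (hs : 0 < s.re) :
    ‖zetaTerm n s‖ ≤ ‖s‖ * ‖s - 1‖ * (n + 1 : ℝ) ^ (-s.re - 1) := by
  set a : ℝ := n + 1 with ha_def
  have ha : 0 < a := by positivity
  have key := (convex_Icc a (a + 1)).norm_image_sub_le_of_norm_hasDerivWithin_le
    (f := fun y : ℝ ↦ (y : ℂ) ^ (1 - s) + (s - 1) * (a : ℂ) ^ (-s) * y)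
    (f' := fun y : ℝ ↦ (1 - s) * (y : ℂ) ^ (1 - s - 1) + (s - 1) * (a : ℂ) ^ (-s) * 1)
    (C := ‖s‖ * ‖s - 1‖ * a ^ (-s.re - 1)) (x := a) (y := a + 1)
    (fun y hy ↦ ((hasDerivAt_ofReal_cpow_of_pos (ha.trans_le hy.1) _).add
      ((hasDerivAt_id y).ofReal_comp.const_mul _)).hasDerivWithinAt)
    (fun y hy ↦ ?_) ⟨le_rfl, by linarith⟩ ⟨by linarith, le_rfl⟩
  · simp only [add_sub_cancel_left, norm_one, mul_one] at key
    refine le_trans (le_of_eq ?_) key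
    rw [zetaTerm, ← ha_def]
    push_cast
    congr 1
    ring
  · have h1 : (1 - s) * (y : ℂ) ^ (1 - s - 1) + (s - 1) * (a : ℂ) ^ (-s) * 1 =
        (1 - s) * ((y : ℂ) ^ (-s) - (a : ℂ) ^ (-s)) := by
      rw [show 1 - s - 1 = -s by ring]; ring
    rw [h1, norm_mul, norm_sub_rev 1 s]
    calc ‖s - 1‖ * ‖(y : ℂ) ^ (-s) - (a : ℂ) ^ (-s)‖
        ≤ ‖s - 1‖ * (‖s‖ * a ^ (-s.re - 1) * (y - a)) := by
          gcongr; exact norm_cpow_neg_sub_cpow_neg_le ha hy.1 hs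
      _ ≤ ‖s - 1‖ * (‖s‖ * a ^ (-s.re - 1) * 1) := by
          gcongr; linarith [hy.2]
      _ = _ := by ring

lemma differentiable_zetaTerm (n : ℕ) : Differentiable ℂ (zetaTerm n) := by
  have h1 : ((n + 1 : ℝ) : ℂ) ≠ 0 := by norm_cast
  have h2 : ((n + 1 + 1 : ℝ) : ℂ) ≠ 0 := by norm_cast
  intro s
  unfold zetaTerm
  refine ((differentiableAt_id.sub_const 1).mul ?_).add (.sub ?_ ?_)
  · exact (differentiableAt_id.neg).const_cpow (Or.inl h1)
  · exact (differentiableAt_id.const_sub 1).const_cpow (Or.inl h2)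
  · exact (differentiableAt_id.const_sub 1).const_cpow (Or.inl h1)

lemma summable_rpow_neg_sub_one {σ : ℝ} (hσ : 0 < σ) :
    Summable fun n : ℕ ↦ (n + 1 : ℝ) ^ (-σ - 1) := by
  have := (summable_nat_add_iff 1).2 (Real.summable_nat_rpow.2 (by linarith : -σ - 1 < -1))
  simpa using this

lemma differentiableOn_tsum_zetaTerm :
    DifferentiableOn ℂ (fun s ↦ ∑' n, zetaTerm n s) {s : ℂ | 0 < s.re} := by
  intro s hs
  have hs : 0 < s.re := hs
  set V : Set ℂ := {z : ℂ | s.re / 2 < z.re} ∩ Metric.ball 0 (‖s‖ + 1)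
  have hV : IsOpen V := (isOpen_lt continuous_const continuous_re).inter Metric.isOpen_ball
  have hsV : s ∈ V := ⟨show s.re / 2 < s.re by linarith, by simp⟩
  refine ((differentiableOn_tsum_of_summable_norm
    (u := fun n : ℕ ↦ (‖s‖ + 1) * (‖s‖ + 2) * (n + 1 : ℝ) ^ (-(s.re / 2) - 1))
    ((summable_rpow_neg_sub_one (half_pos hs)).mul_left _)
    (fun n ↦ (differentiable_zetaTerm n).differentiableOn) hV ?_).differentiableAt
      (hV.mem_nhds hsV)).differentiableWithinAt
  rintro n z ⟨hz1, hz2⟩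
  have hz1 : s.re / 2 < z.re := hz1
  have hz2 : ‖z‖ < ‖s‖ + 1 := by simpa using hz2
  refine (norm_zetaTerm_le n (by linarith)).trans ?_
  have : ‖z - 1‖ ≤ ‖s‖ + 2 := (norm_sub_le _ _).trans (by rw [norm_one]; linarith)
  gcongr
  linarith [(Nat.cast_nonneg n : (0 : ℝ) ≤ n)]

lemma riemannZeta₁_eq_sub_one_mul {s : ℂ} (hs : s ≠ 1) :
    riemannZeta₁ s = (s - 1) * riemannZeta s := by
  rw [riemannZeta_eq_inv_sub_mul hs, mul_inv_cancel_left₀ (sub_ne_zero.2 hs)]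

lemma riemannZeta₁_eq_of_one_lt_re {s : ℂ} (hs : 1 < s.re) :
    riemannZeta₁ s = 1 + ∑' n, zetaTerm n s := by
  have hs1 : s ≠ 1 := by rintro rfl; simp at hs
  rw [riemannZeta₁_eq_sub_one_mul hs1, zeta_eq_tsum_one_div_nat_add_one_cpow hs, eq_comm,
    ← eq_sub_iff_add_eq']
  have hsum : Summable fun n : ℕ ↦ 1 / ((n : ℂ) + 1) ^ s := by
    have := (summable_nat_add_iff 1).2 (Complex.summable_one_div_nat_cpow.2 hs)
    simpa using this
  have htel : Filter.Tendsto (fun N : ℕ ↦ ∑ n ∈ Finset.range N,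
      (((n + 1 + 1 : ℝ) : ℂ) ^ (1 - s) - ((n + 1 : ℝ) : ℂ) ^ (1 - s))) Filter.atTop (nhds (0 - 1)) := by
    have h1 : ∀ N : ℕ, ∑ n ∈ Finset.range N,
        (((n + 1 + 1 : ℝ) : ℂ) ^ (1 - s) - ((n + 1 : ℝ) : ℂ) ^ (1 - s)) =
        ((N + 1 : ℝ) : ℂ) ^ (1 - s) - 1 := by
      intro N
      have := Finset.sum_range_sub (fun n : ℕ ↦ ((n + 1 : ℝ) : ℂ) ^ (1 - s)) N
      simpa using this
    simp_rw [h1]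
    refine Filter.Tendsto.sub_const ?_ _
    rw [tendsto_zero_iff_norm_tendsto_zero]
    have h2 : ∀ N : ℕ, ‖((N + 1 : ℝ) : ℂ) ^ (1 - s)‖ = (N + 1 : ℝ) ^ (-(s.re - 1)) := by
      intro N
      rw [norm_cpow_eq_rpow_re_of_pos (by positivity)]
      simp
    simp_rw [h2]
    exact (tendsto_rpow_neg_atTop (by linarith)).comp
      (Filter.tendsto_atTop_add_const_right _ _ tendsto_natCast_atTop_atTop)
  have hterm : Summable fun n ↦ zetaTerm n s :=
    .of_norm_bounded ((summable_rpow_neg_sub_one (by linarith : 0 < s.re)).mul_left _)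
      (fun n ↦ norm_zetaTerm_le n (by linarith))
  refine tendsto_nhds_unique hterm.hasSum.tendsto_sum_nat ?_
  have h3 := (hsum.hasSum.tendsto_sum_nat.const_mul (s - 1)).add htel
  rw [zero_sub, ← sub_eq_add_neg] at h3
  refine h3.congr fun N ↦ ?_
  rw [Finset.mul_sum, ← Finset.sum_add_distrib]
  refine Finset.sum_congr rfl fun n _ ↦ ?_
  rw [zetaTerm, cpow_neg]
  push_cast
  ring

lemma riemannZeta₁_eq_of_re_pos {s : ℂ} (hs : 0 < s.re) :
    riemannZeta₁ s = 1 + ∑' n, zetaTerm n s := by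
  have hopen : IsOpen {s : ℂ | 0 < s.re} := isOpen_lt continuous_const continuous_re
  have hf : AnalyticOnNhd ℂ riemannZeta₁ {s : ℂ | 0 < s.re} :=
    differentiable_riemannZeta₁.differentiableOn.analyticOnNhd hopen
  have hg : AnalyticOnNhd ℂ (fun s ↦ 1 + ∑' n, zetaTerm n s) {s : ℂ | 0 < s.re} :=
    (differentiableOn_tsum_zetaTerm.const_add 1).analyticOnNhd hopen
  refine hf.eqOn_of_preconnected_of_eventuallyEq hg (convex_halfSpace_re_gt 0).isPreconnected
    (show (2 : ℂ) ∈ _ by simp) ?_ hs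
  filter_upwards [(isOpen_lt continuous_const continuous_re).mem_nhds
    (show (1 : ℝ) < (2 : ℂ).re by simp)] with z hz
  exact riemannZeta₁_eq_of_one_lt_re hz

lemma exists_norm_riemannZeta₁_le {σ₀ : ℝ} (hσ₀ : 0 < σ₀) :
    ∃ Z : ℝ, 0 ≤ Z ∧ ∀ s : ℂ, σ₀ ≤ s.re → ‖riemannZeta₁ s‖ ≤ 1 + Z * (‖s‖ * ‖s - 1‖) := by
  refine ⟨∑' n : ℕ, (n + 1 : ℝ) ^ (-σ₀ - 1), tsum_nonneg fun n ↦ by positivity, fun s hs ↦ ?_⟩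
  rw [riemannZeta₁_eq_of_re_pos (hσ₀.trans_le hs)]
  refine (norm_add_le _ _).trans ?_
  rw [norm_one, mul_comm, ← tsum_mul_left]
  gcongr
  refine tsum_of_norm_bounded ((summable_rpow_neg_sub_one hσ₀).mul_left _).hasSum fun n ↦ ?_
  refine (norm_zetaTerm_le n (hσ₀.trans_le hs)).trans ?_
  gcongr
  linarith [(Nat.cast_nonneg n : (0 : ℝ) ≤ n)]

lemma norm_riemannZeta_two_add_ge (τ : ℝ) : 1 / 3 ≤ ‖riemannZeta (2 + τ * I)‖ := by
  have hre : (2 + τ * I : ℂ).re = 2 := by simp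
  have h2 : Summable fun n : ℕ ↦ 1 / ((n : ℝ) + 1) ^ 2 := by
    have := (summable_nat_add_iff 1).2 (Real.summable_one_div_nat_pow.2 (le_refl 2))
    simpa using this
  have hval : ∑' n : ℕ, 1 / ((n : ℝ) + 1) ^ 2 = Real.pi ^ 2 / 6 := by
    have h := hasSum_zeta_two
    rw [← hasSum_nat_add_iff' 1] at h
    simpa using h.tsum_eq
  have hnorm : ∀ n : ℕ, ‖1 / ((n : ℂ) + 1) ^ (2 + τ * I)‖ = 1 / ((n : ℝ) + 1) ^ 2 := by
    intro n
    rw [norm_div, norm_one]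
    have := norm_cpow_eq_rpow_re_of_pos (by positivity : (0 : ℝ) < n + 1) (2 + τ * I)
    rw [hre] at this
    push_cast at this
    rw [this]
    norm_num
  have hs : Summable fun n : ℕ ↦ 1 / ((n : ℂ) + 1) ^ (2 + τ * I) :=
    .of_norm (by simpa only [hnorm] using h2)
  rw [zeta_eq_tsum_one_div_nat_add_one_cpow (by rw [hre]; norm_num), hs.tsum_eq_zero_add]
  rw [h2.tsum_eq_zero_add] at hval
  have hb : ‖∑' n : ℕ, 1 / (((n + 1 : ℕ) : ℂ) + 1) ^ (2 + τ * I)‖ ≤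
      ∑' n : ℕ, 1 / (((n + 1 : ℕ) : ℝ) + 1) ^ 2 :=
    tsum_of_norm_bounded ((summable_nat_add_iff 1).2 h2).hasSum fun n ↦ (hnorm (n + 1)).le
  have hpi : Real.pi ^ 2 < 10 := by nlinarith [Real.pi_lt_d2, Real.pi_pos]
  simp only [Nat.cast_zero, zero_add, one_pow, one_cpow, div_one] at hval ⊢
  have := norm_sub_le_norm_add (1 : ℂ) (∑' n : ℕ, 1 / (((n + 1 : ℕ) : ℂ) + 1) ^ (2 + τ * I))
  rw [norm_one] at this
  linarith

lemma zeroMult_eq_analyticOrderNatAt {f : ℂ → ℂ} {ρ : ℂ} (hf : AnalyticAt ℂ f ρ)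
    (hρ : analyticOrderAt f ρ ≠ ⊤) : zeroMult f ρ = analyticOrderNatAt f ρ := by
  have hset : {n : ℕ | ∃ g : ℂ → ℂ, AnalyticAt ℂ g ρ ∧ ∀ᶠ z in nhds ρ, f z = (z - ρ) ^ n * g z} =
      Set.Iic (analyticOrderNatAt f ρ) := by
    ext n
    have h := natCast_le_analyticOrderAt hf (n := n)
    rw [← Nat.cast_analyticOrderNatAt hρ, Nat.cast_le] at h
    simp only [smul_eq_mul] at h
    exact h.symm
  rw [zeroMult, hset, csSup_Iic]

lemma analyticAt_riemannZeta {s : ℂ} (hs : s ≠ 1) : AnalyticAt ℂ riemannZeta s :=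
  analyticOn_riemannZeta s hs

lemma analyticOrderAt_riemannZeta_ne_top {s : ℂ} (hs : s ≠ 1) :
    analyticOrderAt riemannZeta s ≠ ⊤ := by
  refine analyticOn_riemannZeta.analyticOrderAt_ne_top_of_isPreconnected
    (isConnected_compl_singleton_of_one_lt_rank (by simp) 1).isPreconnected
    (show (2 : ℂ) ∈ ({1}ᶜ : Set ℂ) by simp) hs ?_
  rw [(analyticAt_riemannZeta (by simp)).analyticOrderAt_eq_zero.2
    (riemannZeta_ne_zero_of_one_le_re Nat.one_le_ofNat)]
  exact ENat.zero_ne_top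

lemma zeroMult_riemannZeta {s : ℂ} (hs : s ≠ 1) :
    zeroMult riemannZeta s = analyticOrderNatAt riemannZeta s :=
  zeroMult_eq_analyticOrderNatAt (analyticAt_riemannZeta hs) (analyticOrderAt_riemannZeta_ne_top hs)

lemma analyticOrderAt_riemannZeta₁ {s : ℂ} (hs : s ≠ 1) :
    analyticOrderAt riemannZeta₁ s = analyticOrderAt riemannZeta s := by
  have h1 : riemannZeta₁ =ᶠ[nhds s] (fun z ↦ z - 1) * riemannZeta := by
    filter_upwards [isOpen_ne.mem_nhds hs] with z hz
    exact riemannZeta₁_eq_sub_one_mul hz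
  have h2 : AnalyticAt ℂ (fun z : ℂ ↦ z - 1) s := by fun_prop
  rw [analyticOrderAt_congr h1, analyticOrderAt_mul h2 (analyticAt_riemannZeta hs),
    h2.analyticOrderAt_eq_zero.2 (sub_ne_zero.2 hs), zero_add]

lemma analyticOrderAt_riemannZeta_eq_completed {s : ℂ} (hs : 0 < s.re) (hs1 : s ≠ 1) :
    analyticOrderAt riemannZeta s = analyticOrderAt completedRiemannZeta s := by
  have hs0 : s ≠ 0 := by rintro rfl; simp at hs
  have h1 : riemannZeta =ᶠ[nhds s] (fun z ↦ (Gammaℝ z)⁻¹) * completedRiemannZeta := by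
    filter_upwards [isOpen_ne.mem_nhds hs0] with z hz
    rw [riemannZeta_def_of_ne_zero hz, div_eq_inv_mul]; rfl
  have h2 : AnalyticAt ℂ (fun z : ℂ ↦ (Gammaℝ z)⁻¹) s :=
    differentiable_Gammaℝ_inv.analyticAt s
  have h3 : AnalyticAt ℂ completedRiemannZeta s := by
    refine DifferentiableOn.analyticAt (s := {0, 1}ᶜ) (fun z hz ↦ ?_)
      ((Set.toFinite {0, 1}).isClosed.isOpen_compl.mem_nhds (by simp [hs0, hs1]))
    simp only [Set.mem_compl_iff, Set.mem_insert_iff, Set.mem_singleton_iff, not_or] at hz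
    exact (differentiableAt_completedZeta hz.1 hz.2).differentiableWithinAt
  rw [analyticOrderAt_congr h1, analyticOrderAt_mul h2 h3,
    h2.analyticOrderAt_eq_zero.2 (inv_ne_zero (Gammaℝ_ne_zero_of_re_pos hs)), zero_add]

lemma zeroMult_riemannZeta_one_sub {s : ℂ} (h0 : 0 < s.re) (h1 : s.re < 1) :
    zeroMult riemannZeta (1 - s) = zeroMult riemannZeta s := by
  have hs1 : s ≠ 1 := by rintro rfl; simp at h1
  have hs0 : s ≠ 0 := by rintro rfl; simp at h0
  have hs1' : 1 - s ≠ 1 := by simpa using hs0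
  have h0' : 0 < (1 - s).re := by simpa using h1
  rw [zeroMult_riemannZeta hs1, zeroMult_riemannZeta hs1', analyticOrderNatAt, analyticOrderNatAt,
    analyticOrderAt_riemannZeta_eq_completed h0 hs1,
    analyticOrderAt_riemannZeta_eq_completed h0' hs1']
  have hd : deriv (fun z : ℂ ↦ 1 - z) s ≠ 0 := by
    simp
  have := analyticOrderAt_comp_of_deriv_ne_zero (f := completedRiemannZeta)
    (show AnalyticAt ℂ (fun z : ℂ ↦ 1 - z) s by fun_prop) hd
  rw [← this]
  congr 2
  ext z
  exact completedRiemannZeta_one_sub z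

open ComplexConjugate in
lemma zeroMult_conj_le {f : ℂ → ℂ} (hf : ∀ s, f (conj s) = conj (f s)) (ρ : ℂ) :
    {n : ℕ | ∃ g : ℂ → ℂ, AnalyticAt ℂ g ρ ∧ ∀ᶠ z in nhds ρ, f z = (z - ρ) ^ n * g z} ⊆
    {n : ℕ | ∃ g : ℂ → ℂ, AnalyticAt ℂ g (conj ρ) ∧
      ∀ᶠ z in nhds (conj ρ), f z = (z - conj ρ) ^ n * g z} := by
  rintro n ⟨g, hg, hfg⟩
  have hcont : Filter.Tendsto conj (nhds (conj ρ)) (nhds ρ) := by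
    simpa using (continuous_conj.tendsto (conj ρ))
  refine ⟨conj ∘ g ∘ conj, ?_, ?_⟩
  · rw [Complex.analyticAt_iff_eventually_differentiableAt] at hg ⊢
    filter_upwards [hcont.eventually hg] with z hz
    have := hz.conj_conj
    rwa [conj_conj] at this
  · filter_upwards [hcont.eventually hfg] with z hz
    have := hf (conj z)
    rw [conj_conj] at this
    rw [this, hz]
    simp

open ComplexConjugate in
lemma zeroMult_riemannZeta_conj (s : ℂ) :
    zeroMult riemannZeta (conj s) = zeroMult riemannZeta s := by
  refine congrArg sSup (Set.Subset.antisymm ?_ (zeroMult_conj_le riemannZeta_conj s))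
  have := zeroMult_conj_le riemannZeta_conj (conj s)
  rwa [conj_conj] at this

lemma zeroMult_riemannZeta_eq_zero {s : ℂ} (hs : s ≠ 1) (h : riemannZeta s ≠ 0) :
    zeroMult riemannZeta s = 0 := by
  rw [zeroMult_riemannZeta hs, analyticOrderNatAt,
    (analyticAt_riemannZeta hs).analyticOrderAt_eq_zero.2 h]
  rfl

/-- The zeros of `ζ` counted by multiplicity in a box of height one are `O(log)` in number. -/
lemma exists_sum_zeroMult_le_log : ∃ C : ℝ, 0 < C ∧ ∀ (t : ℝ) (F : Finset ℂ),
    (∀ ρ ∈ F, 1 / 2 ≤ ρ.re ∧ ρ.re < 1 ∧ t ≤ ρ.im ∧ ρ.im ≤ t + 1) →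
    ∑ ρ ∈ F, (zeroMult riemannZeta ρ : ℝ) ≤ C * Real.log (|t| + 3) := by
  obtain ⟨Z, hZ0, hZ⟩ := exists_norm_riemannZeta₁_le (show (0 : ℝ) < 1 / 10 by norm_num)
  have hlog : 0 < Real.log (19 / 10 / (8 / 5)) := Real.log_pos (by norm_num)
  set q := Real.log (19 / 10 / (8 / 5)) with hq
  refine ⟨(Real.log (3 * (1 + 9 * Z)) + 2) / q, ?_, fun t F hF ↦ ?_⟩
  · have : 0 < Real.log (3 * (1 + 9 * Z)) := Real.log_pos (by linarith)
    positivity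
  set c : ℂ := 2 + ((t + 1 / 2 : ℝ) : ℂ) * I with hc
  have hcre : c.re = 2 := by simp [c]
  have hcim : c.im = t + 1 / 2 := by simp [c]
  have hc1 : c ≠ 1 := fun h ↦ by rw [h] at hcre; norm_num at hcre
  have hfc : 1 / 3 ≤ ‖riemannZeta₁ c‖ := by
    rw [riemannZeta₁_eq_sub_one_mul hc1, norm_mul]
    have h1 : 1 ≤ ‖c - 1‖ := by
      refine le_trans ?_ (Complex.re_le_norm _)
      simp [hcre]; norm_num
    have h2 := norm_riemannZeta_two_add_ge (t + 1 / 2)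
    rw [← hc] at h2
    nlinarith
  have hfc0 : riemannZeta₁ c ≠ 0 := fun h ↦ by rw [h, norm_zero] at hfc; norm_num at hfc
  set τ := |t| + 3 with hτ
  have hτ3 : 3 ≤ τ := by have := abs_nonneg t; linarith
  set M := (1 + 9 * Z) * τ ^ 2 with hM
  have hM1 : 1 ≤ M := by nlinarith
  have hana : AnalyticOnNhd ℂ riemannZeta₁ Set.univ :=
    differentiable_riemannZeta₁.differentiableOn.analyticOnNhd isOpen_univ
  have key := AnalyticOnNhd.sum_divisor_le (c := c) (r := 8 / 5) (R := 19 / 10) (M := M)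
    (f := riemannZeta₁) (by norm_num)
    (by rw [abs_of_pos, abs_of_pos] <;> norm_num) hM1 (hana.mono (Set.subset_univ _)) hfc0 ?_
  · rw [← hq] at key
    have hcl : AnalyticOnNhd ℂ riemannZeta₁ (Metric.closedBall c |8 / 5|) :=
      hana.mono (Set.subset_univ _)
    set d := MeromorphicOn.divisor riemannZeta₁ (Metric.closedBall c |8 / 5|) with hd
    have hfin : (Function.support d).Finite := d.finiteSupport (isCompact_closedBall _ _)
    have hdF : ∀ ρ ∈ F, d ρ = (zeroMult riemannZeta ρ : ℤ) := by
      intro ρ hρ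
      obtain ⟨h1, h2, h3, h4⟩ := hF ρ hρ
      have hρ1 : ρ ≠ 1 := by rintro rfl; simp at h2
      have hmem : ρ ∈ Metric.closedBall c |8 / 5| := by
        rw [Metric.mem_closedBall, dist_eq_norm, abs_of_pos (by norm_num),
          ← sq_le_sq₀ (norm_nonneg _) (by norm_num), Complex.sq_norm, Complex.normSq_apply,
          Complex.sub_re, Complex.sub_im, hcre, hcim]
        nlinarith
      rw [hd, MeromorphicOn.AnalyticOnNhd.divisor_apply hcl hmem, analyticOrderAt_riemannZeta₁ hρ1, zeroMult_riemannZeta hρ1,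
        ← Nat.cast_analyticOrderNatAt (analyticOrderAt_riemannZeta_ne_top hρ1)]
      simp
    have hsum : ∑ ρ ∈ F, d ρ ≤ ∑ᶠ u, d u := by
      rw [finsum_eq_sum_of_support_subset (s := hfin.toFinset ∪ F) d (by simp)]
      exact Finset.sum_le_sum_of_subset_of_nonneg Finset.subset_union_right
        fun i _ _ ↦ MeromorphicOn.AnalyticOnNhd.divisor_nonneg hcl i
    have hle : ∑ ρ ∈ F, (zeroMult riemannZeta ρ : ℝ) ≤ ((∑ᶠ u, d u : ℤ) : ℝ) := by
      rw [Finset.sum_congr rfl hdF] at hsum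
      exact_mod_cast hsum
    refine hle.trans (key.trans ?_)
    rw [div_mul_eq_mul_div]
    gcongr
    have hlogτ : 1 ≤ Real.log τ := by
      rw [Real.le_log_iff_exp_le (by linarith)]
      linarith [Real.exp_one_lt_d9]
    calc Real.log (M / ‖riemannZeta₁ c‖) ≤ Real.log (3 * (1 + 9 * Z) * τ ^ 2) := by
          gcongr
          rw [div_le_iff₀ (by linarith)]
          nlinarith
      _ = Real.log (3 * (1 + 9 * Z)) + 2 * Real.log τ := by
          rw [Real.log_mul (by positivity) (by positivity), Real.log_pow]; norm_num
      _ ≤ _ := by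
          have : 0 < Real.log (3 * (1 + 9 * Z)) := Real.log_pos (by linarith)
          nlinarith
  · intro z hz
    rw [mem_sphere_iff_norm, abs_of_pos (by norm_num)] at hz
    have h1 := Complex.abs_re_le_norm (z - c)
    have h2 := Complex.abs_im_le_norm (z - c)
    rw [hz, Complex.sub_re, hcre, abs_le] at h1
    rw [hz, Complex.sub_im, hcim, abs_le] at h2
    have h3 := hZ z (by linarith)
    have ht := abs_le.1 (le_refl |t|)
    have him : |z.im| ≤ |t| + 5 / 2 := abs_le.2 ⟨by linarith, by linarith⟩
    have hn1 : ‖z‖ ≤ 3 * τ := by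
      have := Complex.norm_le_abs_re_add_abs_im z
      have h5 : |z.re| ≤ 4 := abs_le.2 ⟨by linarith, by linarith⟩
      linarith
    have hn2 : ‖z - 1‖ ≤ 3 * τ := by
      have := Complex.norm_le_abs_re_add_abs_im (z - 1)
      have h5 : |(z - 1).re| ≤ 3 := by
        rw [Complex.sub_re, Complex.one_re]; exact abs_le.2 ⟨by linarith, by linarith⟩
      have h6 : (z - 1).im = z.im := by simp
      rw [h6] at this
      linarith
    have h7 : ‖z‖ * ‖z - 1‖ ≤ (3 * τ) * (3 * τ) := by gcongr
    have h8 : Z * (‖z‖ * ‖z - 1‖) ≤ Z * ((3 * τ) * (3 * τ)) := by gcongr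
    have h9 : 1 ≤ τ ^ 2 := by nlinarith
    rw [hM]
    linarith

lemma two_cosh_sub_two_nonneg (x : ℝ) : 0 ≤ 2 * Real.cosh x - 2 := by
  linarith [Real.one_le_cosh x]

lemma two_cosh_sub_two_le_exp {x : ℝ} (hx : 0 ≤ x) : 2 * Real.cosh x - 2 ≤ Real.exp x := by
  have : Real.exp (-x) ≤ 1 := Real.exp_le_one_iff.2 (by linarith)
  rw [Real.cosh_eq]
  linarith

lemma two_cosh_sub_two_le_sq_mul_exp {x : ℝ} (hx : 0 ≤ x) :
    2 * Real.cosh x - 2 ≤ x ^ 2 * Real.exp x := by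
  have h1 : Real.exp (-x) * Real.exp x = 1 := by rw [← Real.exp_add]; simp
  have h2 : 1 - x ≤ Real.exp (-x) := Real.one_sub_le_exp_neg x
  have h3 := Real.exp_pos x
  have h4 : 1 ≤ Real.exp x := Real.one_le_exp hx
  have h5 : Real.exp x - 1 ≤ x * Real.exp x := by nlinarith
  have h6 : (Real.exp x - 1) ^ 2 ≤ (x * Real.exp x) ^ 2 := by
    gcongr
  rw [Real.cosh_eq]
  have h7 : 2 * ((Real.exp x + Real.exp (-x)) / 2) - 2 = Real.exp (-x) * (Real.exp x - 1) ^ 2 := by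
    linear_combination (2 - Real.exp x) * h1
  rw [h7]
  calc Real.exp (-x) * (Real.exp x - 1) ^ 2 ≤ Real.exp (-x) * (x * Real.exp x) ^ 2 := by gcongr
    _ = x ^ 2 * Real.exp x := by linear_combination (x ^ 2 * Real.exp x) * h1

lemma norm_integral_exp_mul_le {U a : ℝ} (hU : 0 ≤ U) (ha : a ≠ 0) {f f' : ℝ → ℝ}
    (hf : ∀ x, HasDerivAt f (f' x) x) (hf' : Continuous f') (h0 : 0 ≤ f 0)
    (hnonneg : ∀ x, 0 ≤ x → 0 ≤ f' x) :
    ‖∫ ξ in (0 : ℝ)..U, (f ξ : ℂ) * exp (2 * Real.pi * I * a * ξ)‖ ≤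
      f U / (Real.pi * |a|) := by
  have hpi := Real.pi_pos
  set w : ℂ := 2 * Real.pi * I * a with hw
  have hw0 : w ≠ 0 := by simp [hw, ha, hpi.ne']
  have hwn : ‖w‖ = 2 * Real.pi * |a| := by simp [hw, abs_of_pos hpi]
  have hexp : ∀ x : ℝ, ‖exp (w * x) / w‖ = 1 / (2 * Real.pi * |a|) := by
    intro x
    rw [norm_div, hwn, Complex.norm_exp]
    simp [hw]
  have hv : ∀ x : ℝ, HasDerivAt (fun x : ℝ ↦ exp (w * x) / w) (exp (w * x)) x := by
    intro x
    have := (((hasDerivAt_id x).ofReal_comp.const_mul w).cexp).div_const w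
    simpa [mul_div_assoc, hw0] using this
  have hu : ∀ x : ℝ, HasDerivAt (fun x : ℝ ↦ (f x : ℂ)) (f' x : ℂ) x := fun x ↦ (hf x).ofReal_comp
  have hparts := intervalIntegral.integral_mul_deriv_eq_deriv_mul (a := 0) (b := U)
    (fun x _ ↦ hu x) (fun x _ ↦ hv x)
    ((continuous_ofReal.comp hf').intervalIntegrable _ _)
    ((by fun_prop : Continuous fun x : ℝ ↦ exp (w * x)).intervalIntegrable _ _)
  rw [hparts]
  have hFTC : ∫ x in (0 : ℝ)..U, f' x = f U - f 0 :=
    intervalIntegral.integral_eq_sub_of_hasDerivAt (fun x _ ↦ hf x) (hf'.intervalIntegrable _ _)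
  have hmono : 0 ≤ f U - f 0 := by
    rw [← hFTC]
    exact intervalIntegral.integral_nonneg hU fun x hx ↦ hnonneg x hx.1
  have hintegral : ‖∫ x in (0 : ℝ)..U, (f' x : ℂ) * (exp (w * x) / w)‖ ≤
      (f U - f 0) * (1 / (2 * Real.pi * |a|)) := by
    rw [← hFTC, ← intervalIntegral.integral_mul_const]
    refine intervalIntegral.norm_integral_le_of_norm_le hU (Filter.Eventually.of_forall
      fun x hx ↦ ?_) ((hf'.mul continuous_const).intervalIntegrable _ _)
    rw [norm_mul, hexp, Complex.norm_real, Real.norm_of_nonneg (hnonneg x hx.1.le)]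
  have h1 : ‖(f U : ℂ) * (exp (w * U) / w)‖ = f U * (1 / (2 * Real.pi * |a|)) := by
    rw [norm_mul, hexp, Complex.norm_real, Real.norm_of_nonneg (by linarith)]
  have h2 : ‖(f 0 : ℂ) * (exp (w * (0 : ℝ)) / w)‖ = f 0 * (1 / (2 * Real.pi * |a|)) := by
    rw [norm_mul, hexp, Complex.norm_real, Real.norm_of_nonneg h0]
  refine (norm_sub_le _ _).trans ((add_le_add_left (norm_sub_le _ _) _).trans ?_)
  rw [h1, h2]
  have ha' : 0 < |a| := abs_pos.2 ha
  refine (add_le_add_right hintegral _).trans (le_of_eq ?_)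
  field_simp
  ring

lemma norm_integral_exp_mul_le_mul {U a : ℝ} (hU : 0 ≤ U) {f f' : ℝ → ℝ}
    (hf : ∀ x, HasDerivAt f (f' x) x) (h0 : 0 ≤ f 0)
    (hnonneg : ∀ x, 0 ≤ x → 0 ≤ f' x) :
    ‖∫ ξ in (0 : ℝ)..U, (f ξ : ℂ) * exp (2 * Real.pi * I * a * ξ)‖ ≤ f U * U := by
  have hmono : MonotoneOn f (Set.Ici 0) := by
    refine monotoneOn_of_deriv_nonneg (convex_Ici 0)
      (fun x _ ↦ (hf x).continuousAt.continuousWithinAt)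
      (fun x _ ↦ (hf x).differentiableAt.differentiableWithinAt) fun x hx ↦ ?_
    rw [interior_Ici] at hx
    rw [(hf x).deriv]
    exact hnonneg x hx.le
  have := intervalIntegral.norm_integral_le_of_norm_le_const (a := 0) (b := U) (C := f U)
    (f := fun ξ : ℝ ↦ (f ξ : ℂ) * exp (2 * Real.pi * I * a * ξ)) fun x hx ↦ ?_
  · rwa [sub_zero, abs_of_nonneg hU] at this
  · rw [Set.uIoc_of_le hU] at hx
    have hx0 : 0 ≤ f x := h0.trans (hmono Set.self_mem_Ici hx.1.le hx.1.le)
    rw [norm_mul, Complex.norm_exp, Complex.norm_real, Real.norm_of_nonneg hx0]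
    simpa using hmono hx.1.le hU hx.2

/-- A step function dominating `min U (1 / |a|)`. -/
noncomputable def oscKernel (U a : ℝ) : ℝ :=
  if ⌊|a|⌋₊ = 0 then U else 1 / (⌊|a|⌋₊ : ℝ)

lemma oscKernel_nonneg {U : ℝ} (hU : 0 ≤ U) (a : ℝ) : 0 ≤ oscKernel U a := by
  unfold oscKernel
  split_ifs <;> positivity

lemma oscKernel_sub_comm (U a b : ℝ) : oscKernel U (a - b) = oscKernel U (b - a) := by
  unfold oscKernel
  rw [abs_sub_comm]

lemma norm_integral_exp_mul_le_oscKernel {U a : ℝ} (hU : 0 ≤ U) {f f' : ℝ → ℝ}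
    (hf : ∀ x, HasDerivAt f (f' x) x) (hf' : Continuous f') (h0 : 0 ≤ f 0)
    (hnonneg : ∀ x, 0 ≤ x → 0 ≤ f' x) (hfU : 0 ≤ f U) :
    ‖∫ ξ in (0 : ℝ)..U, (f ξ : ℂ) * exp (2 * Real.pi * I * a * ξ)‖ ≤ f U * oscKernel U a := by
  unfold oscKernel
  split_ifs with h
  · exact norm_integral_exp_mul_le_mul hU hf h0 hnonneg
  · have hpos : (0 : ℝ) < (⌊|a|⌋₊ : ℝ) := by exact_mod_cast Nat.pos_of_ne_zero h
    have hle : (⌊|a|⌋₊ : ℝ) ≤ |a| := Nat.floor_le (abs_nonneg a)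
    have ha : a ≠ 0 := fun h0 ↦ by simp [h0] at h
    refine (norm_integral_exp_mul_le hU ha hf hf' h0 hnonneg).trans ?_
    rw [div_eq_mul_one_div]
    gcongr
    nlinarith [Real.pi_gt_three]

lemma norm_integral_exp_mul_cosh_mul_cosh_le {U a b c : ℝ} (hU : 0 ≤ U) (hb : 0 ≤ b)
    (hc : 0 ≤ c) :
    ‖∫ ξ in (0 : ℝ)..U, (((2 * Real.cosh (b * ξ) - 2) * (2 * Real.cosh (c * ξ) - 2) : ℝ) : ℂ) *
        exp (2 * Real.pi * I * a * ξ)‖ ≤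
      (2 * Real.cosh (b * U) - 2) * (2 * Real.cosh (c * U) - 2) * oscKernel U a := by
  have hd : ∀ b x : ℝ, HasDerivAt (fun x ↦ 2 * Real.cosh (b * x) - 2)
      (2 * (Real.sinh (b * x) * b)) x := fun b x ↦ by
    have := ((((hasDerivAt_id x).const_mul b).cosh).const_mul 2).sub_const 2
    simpa using this
  refine norm_integral_exp_mul_le_oscKernel hU (fun x ↦ (hd b x).mul (hd c x)) (by fun_prop)
    (by simp) (fun x hx ↦ ?_) (mul_nonneg (two_cosh_sub_two_nonneg _) (two_cosh_sub_two_nonneg _))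
  have h1 := Real.sinh_nonneg_iff.2 (mul_nonneg hb hx)
  have h2 := Real.sinh_nonneg_iff.2 (mul_nonneg hc hx)
  have h3 := two_cosh_sub_two_nonneg (b * x)
  have h4 := two_cosh_sub_two_nonneg (c * x)
  positivity

lemma integral_norm_sq_sum_exp_mul_cosh_le {ι : Type*} (S : Finset ι) (m γ δ : ι → ℝ)
    (hm : ∀ i ∈ S, 0 ≤ m i) (hδ : ∀ i ∈ S, 0 ≤ δ i) {U : ℝ} (hU : 0 ≤ U) :
    ∫ ξ in (0 : ℝ)..U, ‖∑ i ∈ S, (m i : ℂ) * exp (2 * Real.pi * I * γ i * ξ) *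
        ((2 * Real.cosh (δ i * ξ) - 2 : ℝ) : ℂ)‖ ^ 2 ≤
      ∑ i ∈ S, m i * (2 * Real.cosh (δ i * U) - 2) ^ 2 *
        ∑ j ∈ S, m j * oscKernel U (γ i - γ j) := by
  set h : ℝ → ℝ := fun x ↦ 2 * Real.cosh x - 2 with hh
  have hcont : Continuous h := by fun_prop
  have hnn : ∀ x, 0 ≤ h x := two_cosh_sub_two_nonneg
  have hexpand : ∀ ξ : ℝ, ((‖∑ i ∈ S, (m i : ℂ) * exp (2 * Real.pi * I * γ i * ξ) *
      (h (δ i * ξ) : ℂ)‖ ^ 2 : ℝ) : ℂ) = ∑ i ∈ S, ∑ j ∈ S, ((m i * m j : ℝ) : ℂ) *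
        (((h (δ i * ξ) * h (δ j * ξ) : ℝ) : ℂ) *
          exp (2 * Real.pi * I * ((γ i - γ j : ℝ) : ℂ) * ξ)) := by
    intro ξ
    rw [Complex.ofReal_pow, ← Complex.mul_conj', map_sum, Finset.sum_mul_sum]
    refine Finset.sum_congr rfl fun i _ ↦ Finset.sum_congr rfl fun j _ ↦ ?_
    rw [map_mul, map_mul, Complex.conj_ofReal, Complex.conj_ofReal, ← Complex.exp_conj]
    have h1 : exp (2 * Real.pi * I * ((γ i - γ j : ℝ) : ℂ) * ξ) =
        exp (2 * Real.pi * I * γ i * ξ) *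
          exp ((starRingEnd ℂ) (2 * Real.pi * I * γ j * ξ)) := by
      rw [← Complex.exp_add]
      congr 1
      simp only [map_mul, Complex.conj_ofReal, Complex.conj_I, map_ofNat]
      push_cast
      ring
    rw [h1]
    push_cast
    ring
  have hintegral : ∫ ξ in (0 : ℝ)..U, ((‖∑ i ∈ S, (m i : ℂ) * exp (2 * Real.pi * I * γ i * ξ) *
      (h (δ i * ξ) : ℂ)‖ ^ 2 : ℝ) : ℂ) = ∑ i ∈ S, ∑ j ∈ S, ((m i * m j : ℝ) : ℂ) *
        ∫ ξ in (0 : ℝ)..U, (((h (δ i * ξ) * h (δ j * ξ) : ℝ) : ℂ) *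
          exp (2 * Real.pi * I * ((γ i - γ j : ℝ) : ℂ) * ξ)) := by
    simp_rw [hexpand]
    have hc : ∀ i j, Continuous fun ξ : ℝ ↦ ((m i * m j : ℝ) : ℂ) *
        (((h (δ i * ξ) * h (δ j * ξ) : ℝ) : ℂ) *
          exp (2 * Real.pi * I * ((γ i - γ j : ℝ) : ℂ) * ξ)) := fun i j ↦ by fun_prop
    rw [intervalIntegral.integral_finsetSum fun i _ ↦
      (continuous_finsetSum _ fun j _ ↦ hc i j).intervalIntegrable _ _]
    refine Finset.sum_congr rfl fun i _ ↦ ?_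
    rw [intervalIntegral.integral_finsetSum fun j _ ↦ (hc i j).intervalIntegrable _ _]
    exact Finset.sum_congr rfl fun j _ ↦ intervalIntegral.integral_const_mul _ _
  calc ∫ ξ in (0 : ℝ)..U, ‖∑ i ∈ S, (m i : ℂ) * exp (2 * Real.pi * I * γ i * ξ) *
        (h (δ i * ξ) : ℂ)‖ ^ 2
      ≤ ‖((∫ ξ in (0 : ℝ)..U, ‖∑ i ∈ S, (m i : ℂ) * exp (2 * Real.pi * I * γ i * ξ) *
        (h (δ i * ξ) : ℂ)‖ ^ 2 : ℝ) : ℂ)‖ := by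
        rw [Complex.norm_real]; exact Real.le_norm_self _
    _ ≤ ∑ i ∈ S, ∑ j ∈ S, m i * m j * (h (δ i * U) * h (δ j * U) *
          oscKernel U (γ i - γ j)) := by
        rw [← intervalIntegral.integral_ofReal, hintegral]
        refine (norm_sum_le _ _).trans (Finset.sum_le_sum fun i hi ↦
          (norm_sum_le _ _).trans (Finset.sum_le_sum fun j hj ↦ ?_))
        have hmm := mul_nonneg (hm i hi) (hm j hj)
        rw [norm_mul, Complex.norm_real, Real.norm_of_nonneg hmm]
        exact mul_le_mul_of_nonneg_left
          (norm_integral_exp_mul_cosh_mul_cosh_le hU (hδ i hi) (hδ j hj)) hmm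
    _ ≤ ∑ i ∈ S, ∑ j ∈ S, (m i * m j * (h (δ i * U) ^ 2 * oscKernel U (γ i - γ j)) / 2 +
          m j * m i * (h (δ j * U) ^ 2 * oscKernel U (γ j - γ i)) / 2) := by
        refine Finset.sum_le_sum fun i hi ↦ Finset.sum_le_sum fun j hj ↦ ?_
        have hmm := mul_nonneg (hm i hi) (hm j hj)
        rw [oscKernel_sub_comm U (γ j)]
        have hk := oscKernel_nonneg hU (γ i - γ j)
        have := mul_nonneg (mul_nonneg hmm hk) (sq_nonneg (h (δ i * U) - h (δ j * U)))
        linarith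
    _ = ∑ i ∈ S, ∑ j ∈ S, m i * m j * (h (δ i * U) ^ 2 * oscKernel U (γ i - γ j)) := by
        simp_rw [Finset.sum_add_distrib]
        rw [Finset.sum_comm (f := fun i j ↦ m j * m i *
          (h (δ j * U) ^ 2 * oscKernel U (γ j - γ i)) / 2)]
        simp_rw [← Finset.sum_div]
        ring
    _ = _ := by
        refine Finset.sum_congr rfl fun i _ ↦ ?_
        rw [Finset.mul_sum]
        exact Finset.sum_congr rfl fun j _ ↦ by ring
section Counting

variable {ι : Type*} {S : Finset ι} {m γ δ : ι → ℝ} {D T U : ℝ}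

lemma sum_mul_oscKernel_le (hm : ∀ i ∈ S, 0 ≤ m i) (hT : 1 ≤ T) (hU : 0 ≤ U)
    (hγ : ∀ i ∈ S, 0 < γ i ∧ γ i ≤ T)
    (hD : ∀ t, ∑ i ∈ S with t ≤ γ i ∧ γ i ≤ t + 1, m i ≤ D) {x : ℝ} (hx : 0 < x ∧ x ≤ T) :
    ∑ j ∈ S, m j * oscKernel U (x - γ j) ≤ 2 * D * (U + 1 + Real.log T) := by
  have hD0 : 0 ≤ D := le_trans
    (Finset.sum_nonneg fun i hi ↦ hm i (Finset.mem_filter.1 hi).1) (hD 0)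
  have hmaps : ∀ j ∈ S, ⌊|x - γ j|⌋₊ ∈ Finset.range (⌊T⌋₊ + 1) := by
    intro j hj
    obtain ⟨h1, h2⟩ := hγ j hj
    rw [Finset.mem_range, Nat.lt_succ_iff]
    exact Nat.floor_le_floor (abs_le.2 ⟨by linarith, by linarith⟩)
  rw [← Finset.sum_fiberwise_of_maps_to hmaps]
  have hfib : ∀ k ∈ Finset.range (⌊T⌋₊ + 1),
      ∑ j ∈ S with ⌊|x - γ j|⌋₊ = k, m j * oscKernel U (x - γ j) ≤
        2 * D * (if k = 0 then U else 1 / (k : ℝ)) := by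
    intro k _
    have h1 : ∑ j ∈ S with ⌊|x - γ j|⌋₊ = k, m j * oscKernel U (x - γ j) =
        (∑ j ∈ S with ⌊|x - γ j|⌋₊ = k, m j) * (if k = 0 then U else 1 / (k : ℝ)) := by
      rw [Finset.sum_mul]
      refine Finset.sum_congr rfl fun j hj ↦ ?_
      rw [oscKernel, (Finset.mem_filter.1 hj).2]
    rw [h1]
    have hk : (0 : ℝ) ≤ if k = 0 then U else 1 / (k : ℝ) := by split_ifs <;> positivity
    refine mul_le_mul_of_nonneg_right ?_ hk
    have hsub : (S.filter fun j ↦ ⌊|x - γ j|⌋₊ = k) ⊆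
        (S.filter fun j ↦ x + k ≤ γ j ∧ γ j ≤ x + k + 1) ∪
        (S.filter fun j ↦ x - k - 1 ≤ γ j ∧ γ j ≤ x - k - 1 + 1) := by
      intro j hj
      obtain ⟨hjS, hjk⟩ := Finset.mem_filter.1 hj
      rw [Nat.floor_eq_iff (abs_nonneg _)] at hjk
      simp only [Finset.mem_union, Finset.mem_filter, hjS, true_and]
      rcases le_total 0 (x - γ j) with h | h
      · rw [abs_of_nonneg h] at hjk
        right; constructor <;> linarith [hjk.1, hjk.2]
      · rw [abs_of_nonpos h] at hjk
        left; constructor <;> linarith [hjk.1, hjk.2]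
    calc ∑ j ∈ S with ⌊|x - γ j|⌋₊ = k, m j
        ≤ ∑ j ∈ (S.filter fun j ↦ x + k ≤ γ j ∧ γ j ≤ x + k + 1) ∪
            (S.filter fun j ↦ x - k - 1 ≤ γ j ∧ γ j ≤ x - k - 1 + 1), m j := by
          refine Finset.sum_le_sum_of_subset_of_nonneg hsub fun j hj _ ↦ hm j ?_
          rcases Finset.mem_union.1 hj with h | h <;> exact (Finset.mem_filter.1 h).1
      _ ≤ D + D := by
          refine le_trans ?_ (add_le_add (hD (x + k)) (hD (x - k - 1)))
          rw [← Finset.sum_union_inter]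
          exact le_add_of_nonneg_right (Finset.sum_nonneg fun j hj ↦
            hm j (Finset.mem_filter.1 (Finset.mem_inter.1 hj).1).1)
      _ = 2 * D := by ring
  refine (Finset.sum_le_sum hfib).trans ?_
  rw [← Finset.mul_sum]
  refine mul_le_mul_of_nonneg_left ?_ (by positivity)
  rw [Finset.sum_range_succ']
  have hh := harmonic_floor_le_one_add_log T hT
  rw [harmonic] at hh
  push_cast at hh
  simp only [Nat.add_eq_zero_iff, one_ne_zero, and_false, if_false, if_true, one_div]
  push_cast
  linarith

lemma sum_le_add_one_mul (hm : ∀ i ∈ S, 0 ≤ m i) (hT : 0 ≤ T)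
    (hγ : ∀ i ∈ S, 0 < γ i ∧ γ i ≤ T)
    (hD : ∀ t, ∑ i ∈ S with t ≤ γ i ∧ γ i ≤ t + 1, m i ≤ D) :
    ∑ i ∈ S, m i ≤ (T + 1) * D := by
  have hD0 : 0 ≤ D := le_trans
    (Finset.sum_nonneg fun i hi ↦ hm i (Finset.mem_filter.1 hi).1) (hD 0)
  have hmaps : ∀ j ∈ S, ⌊γ j⌋₊ ∈ Finset.range (⌊T⌋₊ + 1) := by
    intro j hj
    rw [Finset.mem_range, Nat.lt_succ_iff]
    exact Nat.floor_le_floor (hγ j hj).2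
  rw [← Finset.sum_fiberwise_of_maps_to hmaps]
  have hfib : ∀ k ∈ Finset.range (⌊T⌋₊ + 1), ∑ j ∈ S with ⌊γ j⌋₊ = k, m j ≤ D := by
    intro k _
    refine le_trans (Finset.sum_le_sum_of_subset_of_nonneg ?_ ?_) (hD k)
    · intro j hj
      obtain ⟨hjS, hjk⟩ := Finset.mem_filter.1 hj
      rw [Nat.floor_eq_iff (hγ j hjS).1.le] at hjk
      exact Finset.mem_filter.2 ⟨hjS, hjk.1, hjk.2.le⟩
    · exact fun j hj _ ↦ hm j (Finset.mem_filter.1 hj).1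
  refine (Finset.sum_le_card_nsmul _ _ _ hfib).trans ?_
  rw [Finset.card_range, nsmul_eq_mul]
  push_cast
  gcongr
  exact Nat.floor_le hT

/-- Partial summation against an exponentially decaying counting function. -/
lemma sum_mul_exp_le_of_count_le (hm : ∀ i ∈ S, 0 ≤ m i) {M a b u₀ : ℝ} (ha : 0 < a)
    (hb : 0 ≤ b) (hba : b ≤ a / 2) (hu₀ : 0 ≤ u₀)
    (hcount : ∀ u, 0 ≤ u → ∑ i ∈ S with u ≤ δ i, m i ≤ M * Real.exp (-(a * u))) :
    ∑ i ∈ S with u₀ ≤ δ i, m i * Real.exp (b * δ i) ≤ 6 * M * Real.exp (-((a - b) * u₀)) := by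
  have hM : 0 ≤ M := by
    have := le_trans (Finset.sum_nonneg fun i hi ↦ hm i (Finset.mem_filter.1 hi).1) (hcount 0 le_rfl)
    simpa using this
  set J : ℕ := S.sup fun i ↦ ⌊(δ i - u₀) * a⌋₊ with hJ
  set p : ℕ → ℝ := fun j ↦ u₀ + j / a with hp
  have hpt : ∀ i ∈ S, u₀ ≤ δ i → Real.exp (b * δ i) ≤
      ∑ j ∈ Finset.range (J + 1), if p j ≤ δ i then Real.exp (b * p (j + 1)) else 0 := by
    intro i hi hui
    have hnn : 0 ≤ (δ i - u₀) * a := mul_nonneg (by linarith) ha.le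
    set k := ⌊(δ i - u₀) * a⌋₊ with hk
    have hkJ : k ∈ Finset.range (J + 1) := by
      rw [Finset.mem_range, Nat.lt_succ_iff]
      exact Finset.le_sup (f := fun i ↦ ⌊(δ i - u₀) * a⌋₊) hi
    have h1 : (k : ℝ) ≤ (δ i - u₀) * a := Nat.floor_le hnn
    have h2 : (δ i - u₀) * a < k + 1 := Nat.lt_floor_add_one _
    have h3 : p k ≤ δ i := by
      rw [← div_le_iff₀ ha] at h1
      simp only [hp]; linarith
    have h4 : δ i ≤ p (k + 1) := by
      rw [← lt_div_iff₀ ha] at h2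
      simp only [hp]; push_cast; linarith
    calc Real.exp (b * δ i) ≤ Real.exp (b * p (k + 1)) := by gcongr
      _ = if p k ≤ δ i then Real.exp (b * p (k + 1)) else 0 := by rw [if_pos h3]
      _ ≤ _ := Finset.single_le_sum
        (f := fun j ↦ if p j ≤ δ i then Real.exp (b * p (j + 1)) else 0)
        (fun j _ ↦ by positivity) hkJ
  set r := Real.exp (-(1 / 2 : ℝ)) with hr
  have hr0 : 0 < r := Real.exp_pos _
  have hr23 : r ≤ 2 / 3 := by
    have h1 : (1 / 2 : ℝ) + 1 ≤ Real.exp (1 / 2) := Real.add_one_le_exp _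
    rw [hr, Real.exp_neg]
    exact (inv_anti₀ (by norm_num) h1).trans (by norm_num)
  have hexp2 : Real.exp (1 / 2) ≤ 2 := by
    have h1 : Real.exp (1 / 2) * Real.exp (1 / 2) = Real.exp 1 := by
      rw [← Real.exp_add]; norm_num
    nlinarith [Real.exp_one_lt_d9, Real.exp_pos (1 / 2)]
  have hgeom : ∑ j ∈ Finset.range (J + 1), r ^ j ≤ 3 := by
    have h1 := geom_sum_mul_neg r (J + 1)
    have h2 : 0 ≤ r ^ (J + 1) := by positivity
    have h3 : 0 ≤ ∑ j ∈ Finset.range (J + 1), r ^ j := Finset.sum_nonneg fun j _ ↦ by positivity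
    nlinarith
  calc ∑ i ∈ S with u₀ ≤ δ i, m i * Real.exp (b * δ i)
      ≤ ∑ i ∈ S with u₀ ≤ δ i, m i *
          ∑ j ∈ Finset.range (J + 1), if p j ≤ δ i then Real.exp (b * p (j + 1)) else 0 := by
        refine Finset.sum_le_sum fun i hi ↦ ?_
        obtain ⟨hiS, hui⟩ := Finset.mem_filter.1 hi
        exact mul_le_mul_of_nonneg_left (hpt i hiS hui) (hm i hiS)
    _ ≤ ∑ i ∈ S, m i *
          ∑ j ∈ Finset.range (J + 1), if p j ≤ δ i then Real.exp (b * p (j + 1)) else 0 :=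
        Finset.sum_le_sum_of_subset_of_nonneg (Finset.filter_subset _ _) fun i hi _ ↦
          mul_nonneg (hm i hi) (Finset.sum_nonneg fun j _ ↦ by positivity)
    _ = ∑ j ∈ Finset.range (J + 1), (∑ i ∈ S with p j ≤ δ i, m i) * Real.exp (b * p (j + 1)) := by
        simp_rw [Finset.mul_sum]
        rw [Finset.sum_comm]
        refine Finset.sum_congr rfl fun j _ ↦ ?_
        rw [Finset.sum_filter, Finset.sum_mul]
        refine Finset.sum_congr rfl fun i _ ↦ ?_
        split_ifs <;> simp
    _ ≤ ∑ j ∈ Finset.range (J + 1), (2 * M * Real.exp (-((a - b) * u₀))) * r ^ j := by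
        refine Finset.sum_le_sum fun j _ ↦ ?_
        have hpj : 0 ≤ p j := by simp only [hp]; positivity
        have hprod : Real.exp (-(a * p j)) * Real.exp (b * p (j + 1)) ≤
            2 * Real.exp (-((a - b) * u₀)) * r ^ j := by
          have h1 : b / a ≤ 1 / 2 := by rw [div_le_iff₀ ha]; linarith
          have hj0 : (0 : ℝ) ≤ j := Nat.cast_nonneg j
          have h2 : -(a * p j) + b * p (j + 1) ≤
              1 / 2 + -((a - b) * u₀) + j * (-(1 / 2)) := by
            have h3 : -(a * p j) + b * p (j + 1) =
                -((a - b) * u₀) - j + (b / a) * (j + 1) := by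
              simp only [hp]; push_cast; field_simp; ring
            rw [h3]
            nlinarith
          rw [← Real.exp_add, hr, ← Real.exp_nat_mul]
          refine (Real.exp_le_exp.2 h2).trans ?_
          rw [Real.exp_add, Real.exp_add]
          gcongr
        calc (∑ i ∈ S with p j ≤ δ i, m i) * Real.exp (b * p (j + 1))
            ≤ M * Real.exp (-(a * p j)) * Real.exp (b * p (j + 1)) := by
              gcongr; exact hcount _ hpj
          _ = M * (Real.exp (-(a * p j)) * Real.exp (b * p (j + 1))) := by ring
          _ ≤ M * (2 * Real.exp (-((a - b) * u₀)) * r ^ j) := by gcongr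
          _ = _ := by ring
    _ ≤ (2 * M * Real.exp (-((a - b) * u₀))) * 3 := by
        rw [← Finset.mul_sum]
        gcongr
    _ = _ := by ring

end Counting

lemma sq_two_cosh_sub_two_le_exp {x : ℝ} (hx : 0 ≤ x) :
    (2 * Real.cosh x - 2) ^ 2 ≤ Real.exp (2 * x) := by
  calc (2 * Real.cosh x - 2) ^ 2 ≤ Real.exp x ^ 2 :=
        pow_le_pow_left₀ (two_cosh_sub_two_nonneg x) (two_cosh_sub_two_le_exp hx) 2
    _ = Real.exp (2 * x) := by rw [← Real.exp_nat_mul]; norm_num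

lemma sq_two_cosh_sub_two_le_pow_mul_exp {x c : ℝ} (hx : 0 ≤ x) (hxc : x ≤ c) :
    (2 * Real.cosh x - 2) ^ 2 ≤ x ^ 4 * Real.exp (2 * c) := by
  calc (2 * Real.cosh x - 2) ^ 2 ≤ (x ^ 2 * Real.exp x) ^ 2 :=
        pow_le_pow_left₀ (two_cosh_sub_two_nonneg x) (two_cosh_sub_two_le_sq_mul_exp hx) 2
    _ = x ^ 4 * Real.exp (2 * x) := by rw [mul_pow, ← Real.exp_nat_mul]; norm_num; ring
    _ ≤ x ^ 4 * Real.exp (2 * c) := by gcongr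

lemma pow_four_le_mul_exp {c x : ℝ} (hc : 0 < c) (hx : 0 ≤ x) :
    x ^ 4 ≤ 24 / c ^ 4 * Real.exp (c * x) := by
  have := Real.pow_div_factorial_le_exp (c * x) (by positivity) 4
  rw [show ((Nat.factorial 4 : ℕ) : ℝ) = 24 by norm_num [Nat.factorial], mul_pow,
    div_le_iff₀ (by norm_num)] at this
  rw [div_mul_eq_mul_div, le_div_iff₀ (by positivity)]
  linarith

section WeightedSum

variable {ι : Type*} {S : Finset ι} {m δ : ι → ℝ}

/-- The weights `(2 cosh (2π U δ) - 2) ^ 2` are split at the thresholds `δ₀` and `1 / U`. -/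
lemma sq_two_cosh_sub_two_le_split {U x δ₀ c : ℝ} (hU : 0 < U) (hx : 0 ≤ x) (hc : 0 < c) :
    (2 * Real.cosh (2 * Real.pi * x * U) - 2) ^ 2 ≤
      Real.exp (4 * Real.pi) * (2 * Real.pi * U) ^ 4 * δ₀ ^ 4 +
      (if δ₀ ≤ x then Real.exp (4 * Real.pi) * (2 * Real.pi * U) ^ 4 * (24 / c ^ 4) *
        Real.exp (c * x) else 0) +
      (if 1 / U ≤ x then Real.exp (4 * Real.pi * U * x) else 0) := by
  have hpi := Real.pi_pos
  have hy : 0 ≤ 2 * Real.pi * x * U := by positivity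
  have h1 : 0 ≤ Real.exp (4 * Real.pi) * (2 * Real.pi * U) ^ 4 * δ₀ ^ 4 := by positivity
  have h2 : 0 ≤ (if δ₀ ≤ x then Real.exp (4 * Real.pi) * (2 * Real.pi * U) ^ 4 * (24 / c ^ 4) *
      Real.exp (c * x) else 0) := by split_ifs <;> positivity
  have h3 : 0 ≤ (if 1 / U ≤ x then Real.exp (4 * Real.pi * U * x) else 0) := by
    split_ifs <;> positivity
  rcases le_or_gt (1 / U) x with hxU | hxU
  · have := sq_two_cosh_sub_two_le_exp hy
    rw [if_pos hxU]
    rw [show 2 * (2 * Real.pi * x * U) = 4 * Real.pi * U * x by ring] at this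
    linarith
  · have hle : 2 * Real.pi * x * U ≤ 2 * Real.pi := by
      rw [lt_div_iff₀ hU] at hxU
      nlinarith
    have h4 := sq_two_cosh_sub_two_le_pow_mul_exp hy hle
    rw [show 2 * (2 * Real.pi) = 4 * Real.pi by ring] at h4
    rcases le_or_gt δ₀ x with hxd | hxd
    · rw [if_pos hxd] at h2 ⊢
      have h5 := pow_four_le_mul_exp hc hx
      have h6 : (2 * Real.pi * x * U) ^ 4 * Real.exp (4 * Real.pi) ≤
          Real.exp (4 * Real.pi) * (2 * Real.pi * U) ^ 4 * (24 / c ^ 4) * Real.exp (c * x) := by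
        calc (2 * Real.pi * x * U) ^ 4 * Real.exp (4 * Real.pi)
            = Real.exp (4 * Real.pi) * (2 * Real.pi * U) ^ 4 * x ^ 4 := by ring
          _ ≤ Real.exp (4 * Real.pi) * (2 * Real.pi * U) ^ 4 *
              (24 / c ^ 4 * Real.exp (c * x)) := by gcongr
          _ = _ := by ring
      linarith
    · have h6 : (2 * Real.pi * x * U) ^ 4 * Real.exp (4 * Real.pi) ≤
          Real.exp (4 * Real.pi) * (2 * Real.pi * U) ^ 4 * δ₀ ^ 4 := by
        calc (2 * Real.pi * x * U) ^ 4 * Real.exp (4 * Real.pi)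
            = Real.exp (4 * Real.pi) * (2 * Real.pi * U) ^ 4 * x ^ 4 := by ring
          _ ≤ _ := by gcongr
      linarith

lemma sum_mul_sq_two_cosh_le {U M a δ₀ : ℝ} (hm : ∀ i ∈ S, 0 ≤ m i)
    (hδ : ∀ i ∈ S, 0 ≤ δ i) (hU : 0 < U) (ha : 0 < a) (hUa : 4 * Real.pi * U ≤ a / 2)
    (hδ₀ : 0 ≤ δ₀)
    (hcount : ∀ u, 0 ≤ u → ∑ i ∈ S with u ≤ δ i, m i ≤ M * Real.exp (-(a * u))) :
    ∑ i ∈ S, m i * (2 * Real.cosh (2 * Real.pi * δ i * U) - 2) ^ 2 ≤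
      Real.exp (4 * Real.pi) * (2 * Real.pi * U) ^ 4 * δ₀ ^ 4 * ∑ i ∈ S, m i +
      Real.exp (4 * Real.pi) * (2 * Real.pi * U) ^ 4 * (24 / (a / 2) ^ 4) *
        (6 * M * Real.exp (-(a / 2 * δ₀))) +
      6 * M * Real.exp (4 * Real.pi - a / U) := by
  have hpi := Real.pi_pos
  set K := Real.exp (4 * Real.pi) * (2 * Real.pi * U) ^ 4 with hK
  have hK0 : 0 ≤ K := by positivity
  have t1 := sum_mul_exp_le_of_count_le hm ha (by positivity : 0 ≤ a / 2) le_rfl hδ₀ hcount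
  have t2 := sum_mul_exp_le_of_count_le hm ha (by positivity : 0 ≤ 4 * Real.pi * U) hUa
    (by positivity : 0 ≤ 1 / U) hcount
  rw [show a - a / 2 = a / 2 by ring] at t1
  rw [show -((a - 4 * Real.pi * U) * (1 / U)) = 4 * Real.pi - a / U by field_simp; ring] at t2
  calc ∑ i ∈ S, m i * (2 * Real.cosh (2 * Real.pi * δ i * U) - 2) ^ 2
      ≤ ∑ i ∈ S, m i * (K * δ₀ ^ 4 +
        (if δ₀ ≤ δ i then K * (24 / (a / 2) ^ 4) * Real.exp (a / 2 * δ i) else 0) +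
        (if 1 / U ≤ δ i then Real.exp (4 * Real.pi * U * δ i) else 0)) :=
        Finset.sum_le_sum fun i hi ↦ mul_le_mul_of_nonneg_left
          (sq_two_cosh_sub_two_le_split hU (hδ i hi) (half_pos ha)) (hm i hi)
    _ = K * δ₀ ^ 4 * ∑ i ∈ S, m i +
        K * (24 / (a / 2) ^ 4) * ∑ i ∈ S with δ₀ ≤ δ i, m i * Real.exp (a / 2 * δ i) +
        ∑ i ∈ S with 1 / U ≤ δ i, m i * Real.exp (4 * Real.pi * U * δ i) := by
        rw [Finset.sum_filter, Finset.sum_filter, Finset.mul_sum, Finset.mul_sum,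
          ← Finset.sum_add_distrib, ← Finset.sum_add_distrib]
        refine Finset.sum_congr rfl fun i _ ↦ ?_
        split_ifs <;> ring
    _ ≤ _ := by gcongr

end WeightedSum

/-- The mean-square bound for exponential sums whose frequencies satisfy a local density bound
and whose weights satisfy a zero-density-type bound. -/
lemma exists_integral_norm_sq_le (ι : Type*) {A B C₀ C₁ : ℝ} (hA : 0 < A) (hB : 0 < B)
    (hC₀ : 0 ≤ C₀) (hC₁ : 0 ≤ C₁) :
    ∃ C : ℝ, ∀ T U : ℝ, 3 ≤ T → 1 ≤ U → U ≤ A / (8 * Real.pi) * Real.log T →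
      ∀ (S : Finset ι) (m γ δ : ι → ℝ), (∀ i ∈ S, 0 ≤ m i) → (∀ i ∈ S, 0 ≤ δ i) →
      (∀ i ∈ S, 0 < γ i ∧ γ i ≤ T) →
      (∀ t, ∑ i ∈ S with t ≤ γ i ∧ γ i ≤ t + 1, m i ≤ C₁ * Real.log T) →
      (∀ u, 0 ≤ u → ∑ i ∈ S with u ≤ δ i, m i ≤ C₀ * T ^ (1 - A * u) * Real.log T ^ B) →
      ∫ ξ in (0 : ℝ)..U, ‖∑ i ∈ S, (m i : ℂ) * exp (2 * Real.pi * I * γ i * ξ) *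
        ((2 * Real.cosh (2 * Real.pi * δ i * ξ) - 2 : ℝ) : ℂ)‖ ^ 2 ≤
        C * (U ^ 4 * T / Real.log T * Real.log (Real.log T) ^ 4 +
          T ^ (1 - A / U) * Real.log T ^ (B + 2)) := by
  have hpi := Real.pi_pos
  have hL3 : 1 < Real.log 3 := by
    rw [Real.lt_log_iff_exp_lt (by norm_num)]
    linarith [Real.exp_one_lt_d9]
  set ℓ₀ := Real.log (Real.log 3) with hℓ₀
  have hℓ₀pos : 0 < ℓ₀ := Real.log_pos hL3
  set κ := 2 * C₁ * (A / (8 * Real.pi) + 2) with hκ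
  have hκ0 : 0 ≤ κ := by positivity
  set E := Real.exp (4 * Real.pi) with hE
  have hE0 : 0 < E := Real.exp_pos _
  set K₁ := κ * (E * (2 * Real.pi) ^ 4 * (2 * B / A) ^ 4 * (2 * C₁)) with hK₁
  set K₂ := κ * (E * (2 * Real.pi) ^ 4 * (24 / (A / 2) ^ 4) * (6 * C₀) / ℓ₀ ^ 4) with hK₂
  set K₃ := κ * (6 * C₀ * E) with hK₃
  have hK₁0 : 0 ≤ K₁ := by positivity
  have hK₂0 : 0 ≤ K₂ := by positivity
  have hK₃0 : 0 ≤ K₃ := by positivity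
  refine ⟨K₁ + K₂ + K₃, fun T U hT hU hUT S m γ δ hm hδ hγ hD hcount ↦ ?_⟩
  have hT0 : 0 < T := by linarith
  set L := Real.log T with hL
  have hL3' : Real.log 3 ≤ L := Real.log_le_log (by norm_num) hT
  have hL1 : 1 < L := hL3.trans_le hL3'
  have hL0 : 0 < L := by linarith
  set ℓ := Real.log L with hℓ
  have hℓℓ : ℓ₀ ≤ ℓ := Real.log_le_log (by linarith) hL3'
  have hℓ0 : 0 < ℓ := hℓ₀pos.trans_le hℓℓ
  have hU0 : 0 < U := by linarith
  have hUa : 4 * Real.pi * U ≤ A * L / 2 := by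
    calc 4 * Real.pi * U ≤ 4 * Real.pi * (A / (8 * Real.pi) * L) := by gcongr
      _ = A * L / 2 := by field_simp; ring
  have hTexp : ∀ y, T ^ y = Real.exp (L * y) := fun y ↦ Real.rpow_def_of_pos hT0 y
  have hcount' : ∀ u, 0 ≤ u → ∑ i ∈ S with u ≤ δ i, m i ≤
      (C₀ * T * L ^ B) * Real.exp (-(A * L * u)) := by
    intro u hu
    refine (hcount u hu).trans (le_of_eq ?_)
    rw [Real.rpow_sub hT0, Real.rpow_one, hTexp, div_eq_mul_inv, ← Real.exp_neg,
      show -(L * (A * u)) = -(A * L * u) by ring]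
    ring
  set δ₀ := 2 * B / A * (ℓ / L) with hδ₀
  have hW := sum_mul_sq_two_cosh_le (U := U) (a := A * L) (δ₀ := δ₀) hm hδ hU0 (by positivity) hUa
    (by positivity) hcount'
  have htot := sum_le_add_one_mul hm hT0.le hγ hD
  have hinner : ∀ i ∈ S, ∑ j ∈ S, m j * oscKernel U (γ i - γ j) ≤ κ * L ^ 2 := by
    intro i hi
    refine (sum_mul_oscKernel_le hm (by linarith) hU0.le hγ hD (hγ i hi)).trans ?_
    calc 2 * (C₁ * L) * (U + 1 + L) ≤ 2 * (C₁ * L) * (A / (8 * Real.pi) * L + L + L) := by gcongr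
      _ = κ * L ^ 2 := by rw [hκ]; ring
  have hd1 : Real.exp (-(A * L / 2 * δ₀)) * L ^ B = 1 := by
    rw [Real.rpow_def_of_pos hL0, ← Real.exp_add, Real.exp_eq_one_iff, hδ₀]
    field_simp
    ring
  have hd2 : T * Real.exp (4 * Real.pi - A * L / U) = E * T ^ (1 - A / U) := by
    rw [Real.rpow_sub hT0, Real.rpow_one, hTexp, Real.exp_sub,
      show L * (A / U) = A * L / U by ring]
    ring
  have hd3 : L ^ 2 * L ^ B = L ^ (B + 2) := by
    rw [Real.rpow_add hL0, Real.rpow_two]; ring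
  have e1 : κ * L ^ 2 * (E * (2 * Real.pi * U) ^ 4 * δ₀ ^ 4 * ∑ i ∈ S, m i) ≤
      K₁ * (U ^ 4 * T / L * ℓ ^ 4) := by
    calc κ * L ^ 2 * (E * (2 * Real.pi * U) ^ 4 * δ₀ ^ 4 * ∑ i ∈ S, m i)
        ≤ κ * L ^ 2 * (E * (2 * Real.pi * U) ^ 4 * δ₀ ^ 4 * ((2 * T) * (C₁ * L))) := by
          gcongr
          refine htot.trans ?_
          gcongr
          linarith
      _ = K₁ * (U ^ 4 * T / L * ℓ ^ 4) := by
          rw [hK₁, hδ₀]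
          field_simp
  have e2 : κ * L ^ 2 * (E * (2 * Real.pi * U) ^ 4 * (24 / (A * L / 2) ^ 4) *
        (6 * (C₀ * T * L ^ B) * Real.exp (-(A * L / 2 * δ₀)))) ≤
      K₂ * (U ^ 4 * T / L * ℓ ^ 4) := by
    calc κ * L ^ 2 * (E * (2 * Real.pi * U) ^ 4 * (24 / (A * L / 2) ^ 4) *
          (6 * (C₀ * T * L ^ B) * Real.exp (-(A * L / 2 * δ₀))))
        = κ * L ^ 2 * (E * (2 * Real.pi * U) ^ 4 * (24 / (A * L / 2) ^ 4) *
          (6 * (C₀ * T))) * (Real.exp (-(A * L / 2 * δ₀)) * L ^ B) := by ring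
      _ = (K₂ * (U ^ 4 * T / L * ℓ₀ ^ 4)) * (1 / L) := by
          rw [hd1, hK₂]
          field_simp
      _ ≤ (K₂ * (U ^ 4 * T / L * ℓ ^ 4)) * 1 := by
          gcongr
          rw [div_le_one hL0]
          exact hL1.le
      _ = _ := mul_one _
  have e3 : κ * L ^ 2 * (6 * (C₀ * T * L ^ B) * Real.exp (4 * Real.pi - A * L / U)) =
      K₃ * (T ^ (1 - A / U) * L ^ (B + 2)) := by
    rw [hK₃, ← hd3]
    linear_combination (κ * L ^ 2 * 6 * C₀ * L ^ B) * hd2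
  have hP1 : 0 ≤ U ^ 4 * T / L * ℓ ^ 4 := by positivity
  have hP2 : 0 ≤ T ^ (1 - A / U) * L ^ (B + 2) := by positivity
  calc ∫ ξ in (0 : ℝ)..U, ‖∑ i ∈ S, (m i : ℂ) * exp (2 * Real.pi * I * γ i * ξ) *
        ((2 * Real.cosh (2 * Real.pi * δ i * ξ) - 2 : ℝ) : ℂ)‖ ^ 2
      ≤ ∑ i ∈ S, m i * (2 * Real.cosh (2 * Real.pi * δ i * U) - 2) ^ 2 *
        ∑ j ∈ S, m j * oscKernel U (γ i - γ j) :=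
        integral_norm_sq_sum_exp_mul_cosh_le S m γ (fun i ↦ 2 * Real.pi * δ i) hm
          (fun i hi ↦ mul_nonneg (by positivity) (hδ i hi)) hU0.le
    _ ≤ ∑ i ∈ S, m i * (2 * Real.cosh (2 * Real.pi * δ i * U) - 2) ^ 2 * (κ * L ^ 2) :=
        Finset.sum_le_sum fun i hi ↦ mul_le_mul_of_nonneg_left (hinner i hi)
          (mul_nonneg (hm i hi) (sq_nonneg _))
    _ = κ * L ^ 2 * ∑ i ∈ S, m i * (2 * Real.cosh (2 * Real.pi * δ i * U) - 2) ^ 2 := by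
        rw [← Finset.sum_mul, mul_comm]
    _ ≤ _ := mul_le_mul_of_nonneg_left hW (by positivity)
    _ ≤ (K₁ + K₂ + K₃) * (U ^ 4 * T / L * ℓ ^ 4 + T ^ (1 - A / U) * L ^ (B + 2)) := by
        have q1 := mul_nonneg hK₁0 hP2
        have q2 := mul_nonneg hK₂0 hP2
        have q3 := mul_nonneg hK₃0 hP1
        linarith

/-- The zeros of `ζ` in `0 < re s < 1`, `0 < im s ≤ T`. -/
lemma finite_zeros_inZeroBox (T : ℝ) : {ρ : ℂ | inZeroBox ρ T ∧ riemannZeta ρ = 0}.Finite := by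
  refine (((isCompact_Icc (a := (0 : ℝ)) (b := 1)).reProdIm
    (isCompact_Icc (a := (0 : ℝ)) (b := T))).inter_riemannZetaZeros_finite).subset ?_
  rintro ρ ⟨⟨h1, h2, h3, h4⟩, h⟩
  exact ⟨⟨⟨h1.le, h2.le⟩, ⟨h3.le, h4⟩⟩, h⟩

/-- The finite set of zeros of `ζ` with `0 < re s < 1`, `0 < im s ≤ T`. -/
noncomputable def zetaZerosBox (T : ℝ) : Finset ℂ := (finite_zeros_inZeroBox T).toFinset

lemma mem_zetaZerosBox {T : ℝ} {ρ : ℂ} :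
    ρ ∈ zetaZerosBox T ↔ inZeroBox ρ T ∧ riemannZeta ρ = 0 := by
  simp [zetaZerosBox]

lemma zeroMult_eq_zero_of_notMem_zetaZerosBox {T : ℝ} {ρ : ℂ} (h : inZeroBox ρ T)
    (hρ : ρ ∉ zetaZerosBox T) : zeroMult riemannZeta ρ = 0 := by
  refine zeroMult_riemannZeta_eq_zero ?_ fun h0 ↦ hρ (mem_zetaZerosBox.2 ⟨h, h0⟩)
  rintro rfl
  simpa using h.2.1

lemma Dzeta_eq_sum (ξ T : ℝ) : Dzeta ξ T = ∑ ρ ∈ zetaZerosBox T,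
    (zeroMult riemannZeta ρ : ℂ) * exp (2 * Real.pi * I * ρ.im * ξ) *
      (1 - (Real.exp (2 * Real.pi * ξ * (ρ.re - 1 / 2)) : ℂ)) := by
  rw [Dzeta, tsum_eq_sum (s := zetaZerosBox T)]
  · exact Finset.sum_congr rfl fun ρ hρ ↦ if_pos (mem_zetaZerosBox.1 hρ).1
  · intro ρ hρ
    split_ifs with h
    · simp [zeroMult_eq_zero_of_notMem_zetaZerosBox h hρ]
    · rfl

lemma Nzeta_eq_sum (σ T : ℝ) : Nzeta σ T =
    ∑ ρ ∈ zetaZerosBox T with σ ≤ ρ.re, (zeroMult riemannZeta ρ : ℝ) := by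
  rw [Nzeta, tsum_eq_sum (s := zetaZerosBox T), Finset.sum_filter]
  · refine Finset.sum_congr rfl fun ρ hρ ↦ ?_
    obtain ⟨h1, h2, h3, h4⟩ := (mem_zetaZerosBox.1 hρ).1
    simp [h1, h2, h3, h4]
  · intro ρ hρ
    split_ifs with h
    · simp [zeroMult_eq_zero_of_notMem_zetaZerosBox h.2 hρ]
    · rfl

lemma riemannZeta_eq_zero_iff_zeroMult_ne_zero {s : ℂ} (hs : s ≠ 1) :
    riemannZeta s = 0 ↔ zeroMult riemannZeta s ≠ 0 := by
  refine ⟨fun h ↦ ?_, fun h ↦ by_contra fun h0 ↦ h (zeroMult_riemannZeta_eq_zero hs h0)⟩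
  rw [zeroMult_riemannZeta hs, ← Nat.cast_ne_zero (R := ℕ∞),
    Nat.cast_analyticOrderNatAt (analyticOrderAt_riemannZeta_ne_top hs)]
  exact (analyticAt_riemannZeta hs).analyticOrderAt_ne_zero.2 h

open ComplexConjugate in
lemma zeroMult_riemannZeta_one_sub_conj {s : ℂ} (h0 : 0 < s.re) (h1 : s.re < 1) :
    zeroMult riemannZeta (1 - conj s) = zeroMult riemannZeta s := by
  rw [zeroMult_riemannZeta_one_sub (by simpa using h0) (by simpa using h1),
    zeroMult_riemannZeta_conj]

open ComplexConjugate in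
lemma one_sub_conj_mem_zetaZerosBox {T : ℝ} {ρ : ℂ} (hρ : ρ ∈ zetaZerosBox T) :
    1 - conj ρ ∈ zetaZerosBox T := by
  obtain ⟨⟨h1, h2, h3, h4⟩, h⟩ := mem_zetaZerosBox.1 hρ
  have hbox : inZeroBox (1 - conj ρ) T := by
    refine ⟨?_, ?_, ?_, ?_⟩ <;> simpa
  have hne : ρ ≠ 1 := by rintro rfl; simp at h2
  have hne' : 1 - conj ρ ≠ 1 := fun h0 ↦ by
    have := hbox.2.1
    rw [h0] at this
    simp at this
  refine mem_zetaZerosBox.2 ⟨hbox, ?_⟩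
  rw [riemannZeta_eq_zero_iff_zeroMult_ne_zero hne', zeroMult_riemannZeta_one_sub_conj h1 h2]
  exact (riemannZeta_eq_zero_iff_zeroMult_ne_zero hne).1 h

open ComplexConjugate in
/-- Pairing the zeros `β + iγ` and `1 - β + iγ`. -/
lemma Dzeta_eq_neg_sum (ξ T : ℝ) : Dzeta ξ T = -∑ ρ ∈ zetaZerosBox T with 1 / 2 ≤ ρ.re,
    ((zeroMult riemannZeta ρ : ℝ) : ℂ) * exp (2 * Real.pi * I * ρ.im * ξ) *
      ((2 * Real.cosh (2 * Real.pi * (ρ.re - 1 / 2) * ξ) - 2 : ℝ) : ℂ) := by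
  set F : ℂ → ℂ := fun ρ ↦ (zeroMult riemannZeta ρ : ℂ) * exp (2 * Real.pi * I * ρ.im * ξ) *
      (1 - (Real.exp (2 * Real.pi * ξ * (ρ.re - 1 / 2)) : ℂ)) with hF
  have hF0 : ∀ ρ : ℂ, ρ.re = 1 / 2 → F ρ = 0 := fun ρ h ↦ by simp [hF, h]
  have hrefl : ∑ ρ ∈ zetaZerosBox T with ¬ 1 / 2 ≤ ρ.re, F ρ =
      ∑ ρ ∈ zetaZerosBox T with 1 / 2 ≤ ρ.re, F (1 - conj ρ) := by
    have h1 : ∑ ρ ∈ zetaZerosBox T with ¬ 1 / 2 ≤ ρ.re, F ρ =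
        ∑ ρ ∈ zetaZerosBox T with 1 / 2 < ρ.re, F (1 - conj ρ) := by
      refine Finset.sum_nbij' (fun ρ ↦ 1 - conj ρ) (fun ρ ↦ 1 - conj ρ) ?_ ?_ ?_ ?_ ?_
      · intro ρ hρ
        obtain ⟨h1, h2⟩ := Finset.mem_filter.1 hρ
        refine Finset.mem_filter.2 ⟨one_sub_conj_mem_zetaZerosBox h1, ?_⟩
        simp only [sub_re, one_re, conj_re]
        linarith [not_le.1 h2]
      · intro ρ hρ
        obtain ⟨h1, h2⟩ := Finset.mem_filter.1 hρ
        refine Finset.mem_filter.2 ⟨one_sub_conj_mem_zetaZerosBox h1, ?_⟩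
        simp only [sub_re, one_re, conj_re]
        linarith
      · intro ρ _; simp
      · intro ρ _; simp
      · intro ρ _; simp
    rw [h1]
    refine Finset.sum_subset (fun ρ hρ ↦ ?_) fun ρ hρ hρ' ↦ hF0 _ ?_
    · obtain ⟨h1, h2⟩ := Finset.mem_filter.1 hρ
      exact Finset.mem_filter.2 ⟨h1, h2.le⟩
    · obtain ⟨h1, h2⟩ := Finset.mem_filter.1 hρ
      have h3 : ¬ 1 / 2 < ρ.re := fun h ↦ hρ' (Finset.mem_filter.2 ⟨h1, h⟩)
      simp only [sub_re, one_re, conj_re]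
      linarith [not_lt.1 h3]
  rw [Dzeta_eq_sum, ← Finset.sum_filter_add_sum_filter_not _ (fun ρ : ℂ ↦ 1 / 2 ≤ ρ.re), hrefl,
    ← Finset.sum_add_distrib, ← Finset.sum_neg_distrib]
  refine Finset.sum_congr rfl fun ρ hρ ↦ ?_
  obtain ⟨h1, h2, -, -⟩ := (mem_zetaZerosBox.1 (Finset.mem_filter.1 hρ).1).1
  have hcosh : ((2 * Real.cosh (2 * Real.pi * (ρ.re - 1 / 2) * ξ) - 2 : ℝ) : ℂ) =
      (Real.exp (2 * Real.pi * ξ * (ρ.re - 1 / 2)) : ℂ) +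
      (Real.exp (2 * Real.pi * ξ * ((1 - conj ρ).re - 1 / 2)) : ℂ) - 2 := by
    rw [Real.cosh_eq]
    norm_cast
    simp only [sub_re, one_re, conj_re]
    rw [show 2 * Real.pi * (ρ.re - 1 / 2) * ξ = 2 * Real.pi * ξ * (ρ.re - 1 / 2) by ring,
      show 2 * Real.pi * ξ * (1 - ρ.re - 1 / 2) = -(2 * Real.pi * ξ * (ρ.re - 1 / 2)) by ring]
    ring
  have him : (1 - conj ρ).im = ρ.im := by simp
  rw [hcosh]
  simp only [hF]
  rw [zeroMult_riemannZeta_one_sub_conj h1 h2, him, Complex.ofReal_natCast]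
  ring

/-- Lemma 2 of Ford–Zaharescu (for `ζ`): assuming a zero-density estimate
`N(σ,T) ≪ T^{1-A(σ-1/2)}(log T)^B`, one has, uniformly for `T ≥ 3` and
`1 ≤ U ≤ (A/8π) log T`,
`∫₀^U |D(ξ;T)|² dξ ≪ (U⁴T/log T)(log log T)⁴ + T^{1-A/U}(log T)^{B+2}`. -/
theorem Dzeta_squared_integral_bound (A B : ℝ) (hA : 0 < A) (hB : 0 < B)
    (hdensity : ∃ C₀ : ℝ, ∀ σ T : ℝ, 1 / 2 ≤ σ → 2 ≤ T →
      Nzeta σ T ≤ C₀ * T ^ (1 - A * (σ - 1 / 2)) * Real.log T ^ B) :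
    ∃ C : ℝ, ∀ T U : ℝ, 3 ≤ T → 1 ≤ U → U ≤ A / (8 * Real.pi) * Real.log T →
      ∫ ξ in (0 : ℝ)..U, ‖Dzeta ξ T‖ ^ 2 ≤
        C * (U ^ 4 * T / Real.log T * Real.log (Real.log T) ^ 4 +
          T ^ (1 - A / U) * Real.log T ^ (B + 2)) := by
  obtain ⟨C₀, hC₀⟩ := hdensity
  obtain ⟨C₁, hC₁, hlocal⟩ := exists_sum_zeroMult_le_log
  obtain ⟨C, hC⟩ := exists_integral_norm_sq_le ℂ hA hB (abs_nonneg C₀)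
    (by positivity : 0 ≤ C₁ * 3)
  refine ⟨C, fun T U hT hU hUT ↦ ?_⟩
  have hL0 : 0 ≤ Real.log T := Real.log_nonneg (by linarith)
  set S := (zetaZerosBox T).filter fun ρ ↦ 1 / 2 ≤ ρ.re with hS
  have hmem : ∀ ρ ∈ S, inZeroBox ρ T ∧ 1 / 2 ≤ ρ.re := fun ρ hρ ↦
    ⟨(mem_zetaZerosBox.1 (Finset.mem_filter.1 hρ).1).1, (Finset.mem_filter.1 hρ).2⟩
  have hbound := hC T U hT hU hUT S (fun ρ ↦ (zeroMult riemannZeta ρ : ℝ)) (fun ρ ↦ ρ.im)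
    (fun ρ ↦ ρ.re - 1 / 2) (fun ρ _ ↦ Nat.cast_nonneg _)
    (fun ρ hρ ↦ sub_nonneg.2 (hmem ρ hρ).2) (fun ρ hρ ↦ (hmem ρ hρ).1.2.2) ?_ ?_
  · simpa only [Dzeta_eq_neg_sum, norm_neg] using hbound
  · intro t
    by_cases ht : -1 ≤ t ∧ t ≤ T
    · refine (hlocal t _ fun ρ hρ ↦ ?_).trans ?_
      · obtain ⟨h1, h2⟩ := Finset.mem_filter.1 hρ
        exact ⟨(hmem ρ h1).2, (hmem ρ h1).1.2.1, h2⟩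
      · rw [mul_assoc]
        have hlog : Real.log (|t| + 3) ≤ Real.log (T ^ 3) := by
          have habs : |t| ≤ T := abs_le.2 ⟨by linarith [ht.1], ht.2⟩
          refine Real.log_le_log (by positivity) ?_
          nlinarith [mul_nonneg (by linarith : 0 ≤ T) (by nlinarith : 0 ≤ T ^ 2 - 2)]
        rw [Real.log_pow] at hlog
        push_cast at hlog
        gcongr
    · rw [Finset.sum_eq_zero]
      · positivity
      · intro ρ hρ
        obtain ⟨h1, h2, h3⟩ := Finset.mem_filter.1 hρ
        have h4 := (hmem ρ h1).1.2.2
        exact absurd ⟨by linarith [h4.1], h2.trans h4.2⟩ ht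
  · intro u hu
    have h1 := hC₀ (1 / 2 + u) T (by linarith) (by linarith)
    rw [Nzeta_eq_sum, add_sub_cancel_left] at h1
    have h2 : (S.filter fun ρ ↦ u ≤ ρ.re - 1 / 2) =
        (zetaZerosBox T).filter fun ρ ↦ 1 / 2 + u ≤ ρ.re := by
      ext ρ
      simp only [hS, Finset.mem_filter]
      constructor
      · rintro ⟨⟨h1, -⟩, h3⟩; exact ⟨h1, by linarith⟩
      · rintro ⟨h1, h3⟩; exact ⟨⟨h1, by linarith⟩, by linarith⟩
    rw [h2]
    refine h1.trans ?_
    gcongr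
    exact le_abs_self C₀
end

section
/- For an integer k ≥ 0 and real t, let R_{k,2}(t) = ∑_{p prime} (log p)^{k+2}·p^{−2(1+it)}. Then for every compact set S of real numbers with 0 ∉ S, lim_{k→∞} sup_{t∈S} |R_{k,2}(t)| / (k+1)! = 0. -/
open Complex

/-- `R_{k,2}(t) = ∑_p (log p)^{k+2} p^{-2(1+it)}`. -/
noncomputable def Rk2 (k : ℕ) (t : ℝ) : ℂ :=
  ∑' p : Nat.Primes,
    (Real.log (p : ℕ) : ℂ) ^ (k + 2) * ((p : ℕ) : ℂ) ^ (-2 * (1 + t * Complex.I))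

open ArithmeticFunction Filter Topology LSeries
open scoped Nat

lemma logMul_iterate_apply (f : ℕ → ℂ) (m n : ℕ) :
    logMul^[m] f n = (Real.log n : ℂ) ^ m * f n := by
  induction m with
  | zero => simp
  | succ m ih =>
    rw [Function.iterate_succ_apply', logMul, ih, ← natCast_log]
    ring

lemma abscissaOfAbsConv_vonMangoldt_le_one :
    abscissaOfAbsConv (fun n ↦ (Λ n : ℂ)) ≤ 1 :=
  abscissaOfAbsConv_le_of_forall_lt_LSeriesSummable fun y hy ↦
    LSeriesSummable_vonMangoldt (by simpa using hy)

/-- Around a point of real part greater than `1`, the L-series of `Λ` is minus the logarithmic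
derivative of `ζ`, so the Cauchy estimate bounds its derivatives by the size of that on a disk
that may cross `Re s = 1`. -/
lemma norm_LSeries_logMul_iterate_vonMangoldt_le {s : ℂ} {R M : ℝ} (hs : 1 < s.re) (hR : 0 < R)
    (hU : ∀ z ∈ Metric.closedBall s R, z ≠ 1 ∧ riemannZeta z ≠ 0)
    (hM : ∀ z ∈ Metric.closedBall s R, ‖-deriv riemannZeta z / riemannZeta z‖ ≤ M) (m : ℕ) :
    ‖LSeries (logMul^[m] fun n ↦ (Λ n : ℂ)) s‖ ≤ m ! * M / R ^ m := by
  have hab : abscissaOfAbsConv (fun n ↦ (Λ n : ℂ)) < s.re :=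
    abscissaOfAbsConv_vonMangoldt_le_one.trans_lt (mod_cast hs)
  have hev : LSeries (fun n ↦ (Λ n : ℂ)) =ᶠ[𝓝 s]
      fun z ↦ -deriv riemannZeta z / riemannZeta z := by
    filter_upwards [(isOpen_lt continuous_const continuous_re).mem_nhds hs] with z hz
    exact LSeries_vonMangoldt_eq_deriv_riemannZeta_div hz
  have hdζ : DifferentiableOn ℂ riemannZeta {1}ᶜ := fun z hz ↦
    (differentiableAt_riemannZeta hz).differentiableWithinAt
  have hdiff : DifferentiableOn ℂ (fun z ↦ -deriv riemannZeta z / riemannZeta z)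
      (Metric.closedBall s R) :=
    (((hdζ.deriv isOpen_compl_singleton).neg).mono fun z hz ↦ (hU z hz).1).div
      (hdζ.mono fun z hz ↦ (hU z hz).1) fun z hz ↦ (hU z hz).2
  have key := norm_iteratedDeriv_le_of_forall_mem_sphere_norm_le m hR
    (hdiff.diffContOnCl_ball subset_rfl)
    fun z hz ↦ hM z (Metric.sphere_subset_closedBall hz)
  rw [← hev.iteratedDeriv_eq, LSeries_iteratedDeriv m hab] at key
  simpa using key

/-- The zero-free, pole-free disks around the points `2 + 2it`, `t ∈ S`, have a common radius
larger than `1`, on which the logarithmic derivative of `ζ` is uniformly bounded. -/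
lemma exists_radius_bound_logDeriv_riemannZeta {S : Set ℝ} (hS : IsCompact S)
    (h0 : (0 : ℝ) ∉ S) :
    ∃ R M : ℝ, 1 < R ∧ ∀ t ∈ S, ∀ z ∈ Metric.closedBall (2 * (1 + t * I)) R,
      (z ≠ 1 ∧ riemannZeta z ≠ 0) ∧ ‖-deriv riemannZeta z / riemannZeta z‖ ≤ M := by
  set K : Set ℂ := (fun t : ℝ ↦ 2 * (1 + t * I)) '' S with hK
  have hKc : IsCompact K := hS.image (by fun_prop)
  set U : Set ℂ := {z | z ≠ 1 ∧ riemannZeta z ≠ 0}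
  have hdζ : DifferentiableOn ℂ riemannZeta {1}ᶜ := fun z hz ↦
    (differentiableAt_riemannZeta hz).differentiableWithinAt
  have hUo : IsOpen U :=
    hdζ.continuousOn.isOpen_inter_preimage isOpen_compl_singleton isOpen_compl_singleton
  have hKU : Metric.cthickening 1 K ⊆ U := by
    intro z hz
    rw [hKc.cthickening_eq_biUnion_closedBall zero_le_one] at hz
    simp only [hK, Set.mem_iUnion, Set.mem_image, exists_prop] at hz
    obtain ⟨_, ⟨t, ht, rfl⟩, hz⟩ := hz
    rw [mem_closedBall_iff_norm] at hz
    refine ⟨?_, riemannZeta_ne_zero_of_one_le_re ?_⟩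
    · rintro rfl
      have ht0 : t ≠ 0 := fun h ↦ h0 (h ▸ ht)
      have h1 : normSq (1 - 2 * (1 + t * I)) ≤ 1 := by
        rw [normSq_eq_norm_sq]
        exact pow_le_one₀ (norm_nonneg _) hz
      simp [normSq_apply] at h1
      nlinarith [sq_pos_of_ne_zero ht0]
    · have h1 := (abs_le.mp ((abs_re_le_norm _).trans hz)).1
      simp at h1
      linarith
  obtain ⟨δ, hδ, hδU⟩ := hKc.cthickening.exists_cthickening_subset_open hUo hKU
  rw [cthickening_cthickening hδ.le zero_le_one] at hδU
  have hcont : ContinuousOn (fun z ↦ -deriv riemannZeta z / riemannZeta z) U :=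
    (((hdζ.deriv isOpen_compl_singleton).continuousOn.neg).mono fun z hz ↦ hz.1).div
      (hdζ.continuousOn.mono fun z hz ↦ hz.1) fun z hz ↦ hz.2
  obtain ⟨M, hM⟩ := (hKc.cthickening (r := δ + 1)).exists_bound_of_continuousOn
    (hcont.mono hδU)
  refine ⟨δ + 1, M, by linarith, fun t ht z hz ↦ ?_⟩
  have hz' : z ∈ Metric.cthickening (δ + 1) K :=
    Metric.closedBall_subset_cthickening (Set.mem_image_of_mem (fun t : ℝ ↦ 2 * (1 + t * I)) ht)
      (δ + 1) hz
  exact ⟨hδU hz', hM z hz'⟩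

/-- The contribution of the proper prime powers to `∑ Λ(n) (log n)^m / n²` is `o(m!)`. -/
lemma summable_and_tendsto_tsum_vonMangoldt_non_primes :
    (∀ m : ℕ, Summable fun n : ℕ ↦
      (if n.Prime then 0 else Λ n) / n * (Real.log n ^ m / m ! / n)) ∧
    Tendsto (fun m : ℕ ↦ ∑' n : ℕ,
      (if n.Prime then 0 else Λ n) / n * (Real.log n ^ m / m ! / n)) atTop (𝓝 0) := by
  have hsum : Summable fun n : ℕ ↦ (if n.Prime then 0 else Λ n) / (n : ℝ) := by
    refine (vonMangoldt.summable_residueClass_non_primes_div (0 : ZMod 1)).congr fun n ↦ ?_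
    simp [vonMangoldt.residueClass, Set.indicator, Subsingleton.elim (n : ZMod 1) 0]
  have hbound (m n : ℕ) : ‖(if n.Prime then 0 else Λ n) / n * (Real.log n ^ m / m ! / n)‖ ≤
      (if n.Prime then 0 else Λ n) / (n : ℝ) := by
    have hnn : 0 ≤ (if n.Prime then 0 else Λ n) / (n : ℝ) := by
      split_ifs <;> positivity [vonMangoldt_nonneg (n := n)]
    have hlog : 0 ≤ Real.log n := Real.log_natCast_nonneg n
    rw [Real.norm_of_nonneg (by positivity)]
    refine mul_le_of_le_one_right hnn ?_
    rcases n.eq_zero_or_pos with rfl | hn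
    · simp
    · have hn' : (0 : ℝ) < n := mod_cast hn
      rw [div_le_one hn']
      simpa [Real.exp_log hn'] using Real.pow_div_factorial_le_exp _ hlog m
  refine ⟨fun m ↦ hsum.of_norm_bounded (hbound m), ?_⟩
  suffices h : ∀ n : ℕ, Tendsto (fun m : ℕ ↦
      (if n.Prime then 0 else Λ n) / n * (Real.log n ^ m / m ! / n)) atTop (𝓝 0) by
    simpa using tendsto_tsum_of_dominated_convergence hsum h (.of_forall hbound)
  intro n
  simpa using ((FloorSemiring.tendsto_pow_div_factorial_atTop (Real.log n)).div_const
    (n : ℝ)).const_mul ((if n.Prime then 0 else Λ n) / (n : ℝ))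

lemma norm_Rk2_sub_LSeries_le (k : ℕ) (t : ℝ) :
    ‖Rk2 k t - LSeries (logMul^[k + 1] fun n ↦ (Λ n : ℂ)) (2 * (1 + t * I))‖ ≤
      (k + 1)! * ∑' n : ℕ,
        (if n.Prime then 0 else Λ n) / n * (Real.log n ^ (k + 1) / (k + 1)! / n) := by
  set s : ℂ := 2 * (1 + t * I) with hs
  have hre : s.re = 2 := by simp [hs]
  set G : ℕ → ℂ := term (logMul^[k + 1] fun n ↦ (Λ n : ℂ)) s with hG
  have hGs : Summable G := by
    refine LSeriesSummable_of_abscissaOfAbsConv_lt_re ?_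
    rw [absicssaOfAbsConv_logPowMul, hre]
    exact abscissaOfAbsConv_vonMangoldt_le_one.trans_lt (mod_cast one_lt_two)
  have hR : Rk2 k t = ∑' n, {p : ℕ | p.Prime}.indicator G n := by
    rw [← tsum_subtype]
    refine tsum_congr fun p : Nat.Primes ↦ ?_
    rw [hG, term_of_ne_zero p.2.ne_zero, logMul_iterate_apply, vonMangoldt_apply_prime p.2,
      neg_mul, ← hs, cpow_neg, pow_succ _ (k + 1), div_eq_mul_inv]
  rw [hR, LSeries, ← (hGs.indicator _).tsum_sub hGs, ← tsum_mul_left]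
  refine tsum_of_norm_bounded
    ((summable_and_tendsto_tsum_vonMangoldt_non_primes.1 (k + 1)).mul_left _).hasSum fun n ↦ ?_
  by_cases hn : n.Prime
  · simp [hn]
  rcases n.eq_zero_or_pos with rfl | hn0
  · simp [hG]
  have hf : ((k + 1)! : ℝ) ≠ 0 := by positivity
  rw [Set.indicator_of_notMem (by simpa using hn), zero_sub, norm_neg, hG,
    term_of_ne_zero hn0.ne', logMul_iterate_apply, norm_div, norm_natCast_cpow_of_pos hn0, hre,
    if_neg hn, norm_mul, norm_pow, norm_real, norm_real,
    Real.norm_of_nonneg (Real.log_natCast_nonneg n), Real.norm_of_nonneg vonMangoldt_nonneg,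
    Real.rpow_two]
  apply le_of_eq
  field_simp

/-- For every compact `S ⊆ ℝ` with `0 ∉ S`, `sup_{t∈S} |R_{k,2}(t)|/(k+1)! → 0` as `k → ∞`. -/
theorem Rk2_little_o (S : Set ℝ) (hS : IsCompact S) (h0 : (0 : ℝ) ∉ S) :
    ∀ ε : ℝ, 0 < ε → ∃ N : ℕ, ∀ k : ℕ, N ≤ k → ∀ t ∈ S,
      ‖Rk2 k t‖ ≤ ε * ((k + 1).factorial : ℝ) := by
  intro ε hε
  obtain ⟨R, M, hR, hM⟩ := exists_radius_bound_logDeriv_riemannZeta hS h0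
  have hlim : Tendsto (fun m : ℕ ↦ M / R ^ m + ∑' n : ℕ,
      (if n.Prime then 0 else Λ n) / n * (Real.log n ^ m / m ! / n)) atTop (𝓝 0) := by
    simpa using ((tendsto_pow_atTop_atTop_of_one_lt hR).const_div_atTop M).add
      summable_and_tendsto_tsum_vonMangoldt_non_primes.2
  obtain ⟨N, hN⟩ := eventually_atTop.mp (hlim.eventually_le_const hε)
  refine ⟨N, fun k hk t ht ↦ ?_⟩
  have h1 := norm_LSeries_logMul_iterate_vonMangoldt_le (s := 2 * (1 + t * I)) (by simp)
    (by linarith) (fun z hz ↦ (hM t ht z hz).1) (fun z hz ↦ (hM t ht z hz).2) (k + 1)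
  calc ‖Rk2 k t‖
      ≤ _ := norm_le_norm_sub_add _ _
    _ ≤ _ := add_le_add (norm_Rk2_sub_LSeries_le k t) h1
    _ = (M / R ^ (k + 1) + ∑' n : ℕ, (if n.Prime then 0 else Λ n) / n *
          (Real.log n ^ (k + 1) / (k + 1)! / n)) * (k + 1)! := by ring
    _ ≤ ε * (k + 1)! := by
        gcongr
        exact hN (k + 1) (by omega)
end

section
/- There is an absolute constant C such that for every integer k ≥ 1 and every complex number s with Re s = 1, | ∑_{l=3}^{∞} (l^k − l^{k+1}) ∑_{p prime} (log p)^{k+2}·p^{−ls} | ≤ C·(3/2)^k·(k+1)!. -/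
open Complex

open scoped Nat
open MeasureTheory

/-- Chebyshev's bound `θ(x) ≤ x log 4`, for an arbitrary finite set of primes at most `exp u`. -/
lemma sum_log_primes_le (S : Finset Nat.Primes) (u : ℝ) :
    ∑ p ∈ S with Real.log ((p : Nat.Primes) : ℕ) ≤ u, Real.log (p : ℕ) ≤
      Real.log 4 * Real.exp u := by
  refine le_trans ?_ (Chebyshev.theta_le_log4_mul_x (Real.exp_pos u).le)
  rw [Chebyshev.theta]
  refine (Finset.sum_map _ (⟨fun p ↦ p, Subtype.val_injective⟩ : Nat.Primes ↪ ℕ)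
    (fun n : ℕ ↦ Real.log n)).symm.le.trans ?_
  refine Finset.sum_le_sum_of_subset_of_nonneg ?_ fun n _ _ ↦ Real.log_natCast_nonneg n
  intro n hn
  simp only [Finset.mem_map, Finset.mem_filter] at hn
  obtain ⟨p, ⟨-, hp⟩, rfl⟩ := hn
  have h0 : (0 : ℝ) < ((p : ℕ) : ℝ) := by exact_mod_cast p.2.pos
  simp only [Finset.mem_filter, Finset.mem_Ioc]
  exact ⟨⟨p.2.pos, Nat.le_floor ((Real.log_le_iff_le_exp h0).1 hp)⟩, p.2⟩

lemma integral_pow_mul_exp_neg_two_mul (m : ℕ) :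
    IntegrableOn (fun u : ℝ ↦ u ^ m * Real.exp (-(2 * u))) (Set.Ioi 0) ∧
      ∫ u in Set.Ioi (0 : ℝ), u ^ m * Real.exp (-(2 * u)) = m ! / 2 ^ (m + 1) := by
  have h : ∫ u in Set.Ioi (0 : ℝ), u ^ m * Real.exp (-(2 * u)) = m ! / 2 ^ (m + 1) := by
    have := Real.integral_rpow_mul_exp_neg_mul_Ioi (a := (m : ℝ) + 1) (r := 2)
      (by positivity) (by norm_num)
    rw [Real.Gamma_nat_eq_factorial] at this
    simp only [add_sub_cancel_right, Real.rpow_natCast] at this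
    rw [this, ← Nat.cast_add_one, Real.rpow_natCast, one_div, inv_pow, div_eq_inv_mul]
  refine ⟨?_, h⟩
  by_contra hn
  rw [integral_undef hn] at h
  exact absurd h (by positivity)

lemma pow_mul_exp_le_integral (m : ℕ) {a : ℝ} (ha : 0 ≤ a) :
    a ^ m * Real.exp (-(3 * a)) ≤
      Real.exp 3 * ∫ u in Set.Ioc a (a + 1), u ^ m * Real.exp (-(3 * u)) := by
  have hc : Continuous fun u : ℝ ↦ u ^ m * Real.exp (-(3 * u)) := by fun_prop
  have h : ∫ u in Set.Ioc a (a + 1), a ^ m * Real.exp (-(3 * (a + 1))) ≤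
      ∫ u in Set.Ioc a (a + 1), u ^ m * Real.exp (-(3 * u)) := by
    refine setIntegral_mono_on (integrableOn_const (by simp)) hc.integrableOn_Ioc
      measurableSet_Ioc ?_
    intro u hu
    have := hu.1
    have hu0 : 0 ≤ u := ha.trans hu.1.le
    have := hu.2
    gcongr
  simp only [setIntegral_const, Measure.real, Real.volume_Ioc] at h
  simp only [add_sub_cancel_left, ENNReal.ofReal_one, ENNReal.toReal_one, one_smul] at h
  calc a ^ m * Real.exp (-(3 * a)) =
      Real.exp 3 * (a ^ m * Real.exp (-(3 * (a + 1)))) := by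
        rw [mul_left_comm, ← Real.exp_add]; ring_nf
    _ ≤ _ := by gcongr

lemma sum_log_pow_mul_exp_le (m : ℕ) (S : Finset Nat.Primes) :
    ∑ p ∈ S, Real.log (p : ℕ) ^ (m + 1) * Real.exp (-(3 * Real.log (p : ℕ))) ≤
      Real.exp 3 * Real.log 4 * (m ! / 2 ^ (m + 1)) := by
  have hlog (p : Nat.Primes) : 0 ≤ Real.log (p : ℕ) := Real.log_natCast_nonneg _
  set f : ℝ → ℝ := fun u ↦ u ^ m * Real.exp (-(3 * u)) with hf
  have hc : Continuous f := by fun_prop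
  let I (p : Nat.Primes) : Set ℝ := Set.Ioc (Real.log (p : ℕ)) (Real.log (p : ℕ) + 1)
  have hI (p : Nat.Primes) : I p ⊆ Set.Ioi 0 := fun u hu ↦ (hlog p).trans_lt hu.1
  obtain ⟨hint, hval⟩ := integral_pow_mul_exp_neg_two_mul m
  have hterm (p : Nat.Primes) : Integrable
      (fun u ↦ Real.log (p : ℕ) * (I p).indicator f u) (volume.restrict (Set.Ioi 0)) :=
    ((hc.integrableOn_Ioc.integrable_indicator measurableSet_Ioc).integrableOn).const_mul _
  calc ∑ p ∈ S, Real.log (p : ℕ) ^ (m + 1) * Real.exp (-(3 * Real.log (p : ℕ)))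
      ≤ ∑ p ∈ S, Real.exp 3 *
          ∫ u in Set.Ioi (0 : ℝ), Real.log (p : ℕ) * (I p).indicator f u := by
        refine Finset.sum_le_sum fun p _ ↦ ?_
        rw [integral_const_mul, setIntegral_indicator measurableSet_Ioc,
          Set.inter_eq_right.2 (hI p)]
        have := mul_le_mul_of_nonneg_left (pow_mul_exp_le_integral m (hlog p)) (hlog p)
        calc _ = _ := by ring
          _ ≤ _ := this
          _ = _ := by ring
    _ = Real.exp 3 * ∫ u in Set.Ioi (0 : ℝ), ∑ p ∈ S, Real.log (p : ℕ) * (I p).indicator f u := by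
        rw [integral_finsetSum _ fun p _ ↦ hterm p, Finset.mul_sum]
    _ ≤ Real.exp 3 * ∫ u in Set.Ioi (0 : ℝ), Real.log 4 * (u ^ m * Real.exp (-(2 * u))) := by
        refine mul_le_mul_of_nonneg_left ?_ (Real.exp_pos 3).le
        refine setIntegral_mono_on (integrable_finsetSum _ fun p _ ↦ hterm p)
          (hint.const_mul _) measurableSet_Ioi fun u hu ↦ ?_
        have hu0 : (0 : ℝ) < u := hu
        have hfu : 0 ≤ f u := by positivity
        calc ∑ p ∈ S, Real.log (p : ℕ) * (I p).indicator f u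
            ≤ ∑ p ∈ S, if Real.log (p : ℕ) ≤ u then Real.log (p : ℕ) * f u else 0 := by
              refine Finset.sum_le_sum fun p _ ↦ ?_
              have := hlog p
              by_cases hm : u ∈ I p
              · rw [Set.indicator_of_mem hm, if_pos hm.1.le]
              · rw [Set.indicator_of_notMem hm, mul_zero]
                split_ifs <;> positivity
          _ = (∑ p ∈ S with Real.log ((p : Nat.Primes) : ℕ) ≤ u, Real.log (p : ℕ)) * f u := by
              rw [← Finset.sum_filter, Finset.sum_mul]
          _ ≤ Real.log 4 * Real.exp u * f u := by
              gcongr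
              exact sum_log_primes_le S u
          _ = Real.log 4 * (u ^ m * Real.exp (-(2 * u))) := by
              rw [hf, show -(2 * u) = u + -(3 * u) by ring, Real.exp_add]
              ring
    _ = _ := by rw [integral_const_mul, hval, mul_assoc]

lemma summable_log_sq_mul_exp :
    Summable fun p : Nat.Primes ↦
      Real.log (p : ℕ) ^ 2 * Real.exp (-(4 / 3 * Real.log (p : ℕ))) := by
  have h : Summable fun p : Nat.Primes ↦ 144 * ((p : ℕ) : ℝ) ^ (-(7 / 6) : ℝ) :=
    (Nat.Primes.summable_rpow.2 (by norm_num)).mul_left _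
  refine h.of_nonneg_of_le (fun p ↦ by positivity) fun p ↦ ?_
  have h0 : (0 : ℝ) < ((p : ℕ) : ℝ) := by exact_mod_cast p.2.pos
  have hlog : 0 ≤ Real.log (p : ℕ) := Real.log_natCast_nonneg _
  have h1 : Real.log (p : ℕ) ^ 2 ≤ 144 * Real.exp (Real.log (p : ℕ) / 6) := by
    have h2 : Real.log (p : ℕ) ≤ 12 * Real.exp (Real.log (p : ℕ) / 12) := by
      linarith [Real.add_one_le_exp (Real.log (p : ℕ) / 12)]
    calc Real.log (p : ℕ) ^ 2 ≤ (12 * Real.exp (Real.log (p : ℕ) / 12)) ^ 2 := by gcongr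
      _ = _ := by rw [mul_pow, ← Real.exp_nat_mul]; push_cast; ring_nf
  calc _ ≤ 144 * Real.exp (Real.log (p : ℕ) / 6) * Real.exp (-(4 / 3 * Real.log (p : ℕ))) := by
        gcongr
    _ = _ := by
        rw [Real.rpow_def_of_pos h0, mul_assoc, ← Real.exp_add]
        ring_nf

lemma norm_log_pow_mul_prime_cpow (p : Nat.Primes) (j L : ℕ) {s : ℂ} (hs : s.re = 1) :
    ‖(Real.log (p : ℕ) : ℂ) ^ j * ((p : ℕ) : ℂ) ^ (-(L : ℂ) * s)‖ =
      Real.log (p : ℕ) ^ j * Real.exp (-(L * Real.log (p : ℕ))) := by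
  have h0 : (0 : ℝ) < ((p : ℕ) : ℝ) := by exact_mod_cast p.2.pos
  rw [norm_mul, norm_pow, Complex.norm_real, Real.norm_of_nonneg (Real.log_natCast_nonneg _),
    Complex.norm_natCast_cpow_of_pos p.2.pos, Real.rpow_def_of_pos h0]
  simp [hs, mul_comm]

lemma pow_mul_log_pow_mul_exp_le (p : Nat.Primes) (k n : ℕ) :
    ((n + 4 : ℕ) : ℝ) ^ k *
        (Real.log (p : ℕ) ^ (k + 2) * Real.exp (-((n + 4 : ℕ) * Real.log (p : ℕ)))) ≤
      (3 / 2) ^ k * k ! * Real.exp (-(Real.log 2 / 3)) ^ n *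
        (Real.log (p : ℕ) ^ 2 * Real.exp (-(4 / 3 * Real.log (p : ℕ)))) := by
  set x := Real.log (p : ℕ)
  have h2 : Real.log 2 ≤ x := Real.log_le_log (by norm_num) (by exact_mod_cast p.2.two_le)
  have hx : 0 ≤ x := Real.log_natCast_nonneg _
  set L : ℝ := ((n + 4 : ℕ) : ℝ) with hL
  have hL0 : 0 ≤ L := by positivity
  have h1 : (L * x) ^ k ≤ (3 / 2) ^ k * k ! * Real.exp (2 / 3 * (L * x)) := by
    have := Real.pow_div_factorial_le_exp (2 / 3 * (L * x)) (by positivity) k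
    rw [div_le_iff₀ (by positivity)] at this
    calc (L * x) ^ k = (3 / 2) ^ k * (2 / 3 * (L * x)) ^ k := by rw [← mul_pow]; ring_nf
      _ ≤ (3 / 2) ^ k * (Real.exp (2 / 3 * (L * x)) * k !) := by gcongr
      _ = _ := by ring
  calc L ^ k * (x ^ (k + 2) * Real.exp (-(L * x)))
      = (L * x) ^ k * x ^ 2 * Real.exp (-(L * x)) := by ring
    _ ≤ (3 / 2) ^ k * k ! * Real.exp (2 / 3 * (L * x)) * x ^ 2 * Real.exp (-(L * x)) := by gcongr
    _ = (3 / 2) ^ k * k ! * x ^ 2 * Real.exp (n * -(x / 3) + -(4 / 3 * x)) := by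
        rw [show n * -(x / 3) + -(4 / 3 * x) = 2 / 3 * (L * x) + -(L * x) by
          rw [hL]; push_cast; ring, Real.exp_add]
        ring
    _ ≤ (3 / 2) ^ k * k ! * x ^ 2 * Real.exp (n * -(Real.log 2 / 3) + -(4 / 3 * x)) := by gcongr
    _ = _ := by rw [Real.exp_add, Real.exp_nat_mul]; ring

lemma summable_mul_exp_neg_pow :
    Summable fun n : ℕ ↦ ((n : ℝ) + 3) * Real.exp (-(Real.log 2 / 3)) ^ n := by
  have hr : ‖Real.exp (-(Real.log 2 / 3))‖ < 1 := by
    rw [Real.norm_of_nonneg (Real.exp_pos _).le, Real.exp_lt_one_iff]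
    have := Real.log_pos one_lt_two
    linarith
  have h1 := summable_pow_mul_geometric_of_norm_lt_one 1 hr
  have h0 := (summable_geometric_of_norm_lt_one hr).mul_left 3
  simpa [add_mul] using h1.add h0

lemma norm_pow_sub_pow_succ (L k : ℕ) :
    ‖((L + 1 : ℕ) : ℂ) ^ k - ((L + 1 : ℕ) : ℂ) ^ (k + 1)‖ = L * ((L + 1 : ℕ) : ℝ) ^ k := by
  rw [show ((L + 1 : ℕ) : ℂ) ^ k - ((L + 1 : ℕ) : ℂ) ^ (k + 1) =
    -((L : ℂ) * ((L + 1 : ℕ) : ℂ) ^ k) by push_cast; ring, norm_neg, norm_mul, norm_pow,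
    Complex.norm_natCast, Complex.norm_natCast]

lemma norm_tsum_log_pow_mul_prime_cpow_three_le (m : ℕ) {s : ℂ} (hs : s.re = 1) :
    ‖∑' p : Nat.Primes, (Real.log (p : ℕ) : ℂ) ^ (m + 1) *
        ((p : ℕ) : ℂ) ^ (-((3 : ℕ) : ℂ) * s)‖ ≤
      Real.exp 3 * Real.log 4 * (m ! / 2 ^ (m + 1)) := by
  have hnn (p : Nat.Primes) :
      0 ≤ Real.log (p : ℕ) ^ (m + 1) * Real.exp (-(3 * Real.log (p : ℕ))) :=
    mul_nonneg (pow_nonneg (Real.log_natCast_nonneg _) _) (Real.exp_pos _).le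
  refine (tsum_of_norm_bounded
    (summable_of_sum_le hnn (sum_log_pow_mul_exp_le m)).hasSum fun p ↦ ?_).trans
    (Real.tsum_le_of_sum_le hnn (sum_log_pow_mul_exp_le m))
  exact (norm_log_pow_mul_prime_cpow p (m + 1) 3 hs).le.trans_eq (by norm_num)

lemma pow_mul_norm_tsum_log_pow_mul_prime_cpow_le (k n : ℕ) {s : ℂ} (hs : s.re = 1) :
    ((n + 4 : ℕ) : ℝ) ^ k * ‖∑' p : Nat.Primes, (Real.log (p : ℕ) : ℂ) ^ (k + 2) *
        ((p : ℕ) : ℂ) ^ (-((n + 4 : ℕ) : ℂ) * s)‖ ≤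
      (3 / 2) ^ k * k ! * Real.exp (-(Real.log 2 / 3)) ^ n *
        ∑' p : Nat.Primes, Real.log (p : ℕ) ^ 2 * Real.exp (-(4 / 3 * Real.log (p : ℕ))) := by
  have hL : (0 : ℝ) < ((n + 4 : ℕ) : ℝ) ^ k := by positivity
  rw [← le_div_iff₀' hL]
  refine tsum_of_norm_bounded ((summable_log_sq_mul_exp.hasSum.mul_left _).div_const _) fun p ↦ ?_
  rw [norm_log_pow_mul_prime_cpow p (k + 2) (n + 4) hs, le_div_iff₀' hL]
  exact pow_mul_log_pow_mul_exp_le p k n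

/-- There is an absolute constant `C` such that for every `k ≥ 1` and every `s` with
`Re s = 1`, `|∑_{l≥3} (l^k - l^{k+1}) ∑_p (log p)^{k+2} p^{-ls}| ≤ C (3/2)^k (k+1)!`. -/
theorem higher_prime_power_sum_bound :
    ∃ C : ℝ, ∀ k : ℕ, 1 ≤ k → ∀ s : ℂ, s.re = 1 →
      ‖∑' l : ℕ, (((l + 3 : ℕ) : ℂ) ^ k - ((l + 3 : ℕ) : ℂ) ^ (k + 1)) *
          ∑' p : Nat.Primes,
            (Real.log (p : ℕ) : ℂ) ^ (k + 2) * ((p : ℕ) : ℂ) ^ (-(((l + 3 : ℕ) : ℂ)) * s)‖ ≤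
        C * (3 / 2 : ℝ) ^ k * ((k + 1).factorial : ℝ) := by
  set D : ℝ := ∑' p : Nat.Primes,
    Real.log (p : ℕ) ^ 2 * Real.exp (-(4 / 3 * Real.log (p : ℕ)))
  have hD : 0 ≤ D := tsum_nonneg fun p ↦ by positivity
  let b : ℕ → ℝ := fun l ↦ Nat.casesOn l (Real.exp 3 * Real.log 4)
    fun n ↦ ((n : ℝ) + 3) * Real.exp (-(Real.log 2 / 3)) ^ n * D
  have hb : Summable b := (summable_nat_add_iff 1).1 (summable_mul_exp_neg_pow.mul_right D)
  refine ⟨∑' l, b l, fun k _ s hs ↦ ?_⟩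
  rw [mul_assoc]
  refine tsum_of_norm_bounded (hb.hasSum.mul_right _) fun l ↦ ?_
  rw [norm_mul, norm_pow_sub_pow_succ (l + 2) k]
  cases l with
  | zero =>
    have h := norm_tsum_log_pow_mul_prime_cpow_three_le (k + 1) hs
    have h4 : 0 ≤ Real.log 4 := Real.log_nonneg (by norm_num)
    calc ((0 + 2 : ℕ) : ℝ) * ((0 + 2 + 1 : ℕ) : ℝ) ^ k * _
        ≤ ((0 + 2 : ℕ) : ℝ) * ((0 + 2 + 1 : ℕ) : ℝ) ^ k *
          (Real.exp 3 * Real.log 4 * ((k + 1)! / 2 ^ (k + 1 + 1))) := by gcongr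
      _ = 1 / 2 * (Real.exp 3 * Real.log 4 * ((3 / 2) ^ k * (k + 1)!)) := by
        rw [div_pow]; push_cast; field_simp; norm_num; ring
      _ ≤ Real.exp 3 * Real.log 4 * ((3 / 2) ^ k * (k + 1)!) := by
        have : 0 ≤ Real.exp 3 * Real.log 4 * ((3 / 2) ^ k * (k + 1)!) := by positivity
        linarith
  | succ n =>
    have h := pow_mul_norm_tsum_log_pow_mul_prime_cpow_le k n hs
    have hk : (k ! : ℝ) ≤ (k + 1)! := by exact_mod_cast Nat.factorial_le k.le_succ
    rw [mul_assoc]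
    calc ((n + 1 + 2 : ℕ) : ℝ) * _
        ≤ ((n + 1 + 2 : ℕ) : ℝ) *
          ((3 / 2) ^ k * k ! * Real.exp (-(Real.log 2 / 3)) ^ n * D) := by gcongr
      _ ≤ ((n + 1 + 2 : ℕ) : ℝ) *
          ((3 / 2) ^ k * (k + 1)! * Real.exp (-(Real.log 2 / 3)) ^ n * D) := by gcongr
      _ = ((n : ℝ) + 3) * Real.exp (-(Real.log 2 / 3)) ^ n * D * ((3 / 2) ^ k * (k + 1)!) := by
        push_cast; ring
end
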